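/- Let Ω = (−1,1)^d with d ≥ 2 and 1 < p < ∞, and write x = (x̄, x_d) ∈ ℝ^{d−1} × ℝ, p′ = p/(p−1). Then there exist exponents α < β lying either in (−1/p, 1/p′) together with comparison weights ω⁻(x) = ε|x_d|^β, ω⁺(x) = |x_d|^α, or in (−(d−1)/p, (d−1)/p′) together with ω⁻(x) = ε|x̄|^β, ω⁺(x) = |x̄|^α, a constant ε > 0, a measurable weight ω : Ω → [0,∞) with ω⁻ ≤ ω ≤ ω⁺ on Ω (so that ω is sandwiched between two weights whose p-th powers are Muckenhoupt A_p weights), and a vector field b° ∈ L^1(Ω;ℝ^d), supported in a compact subset of Ω and satisfying ∫_Ω (|b°(x)|/ω(x))^{p′} dx < ∞, such that with φ(x,t) := (ω(x)·t)^p/p: (i) ∫_Ω b° · ∇v dx = 0 for every v ∈ C^∞(Ω), hence G(v) := ∫_Ω φ(x, |∇v(x)|) dx + ∫_Ω b° · ∇v dx ≥ 0 for every v ∈ C_c^∞(Ω); (ii) there exists w ∈ W_0^{1,1}(Ω) with ∫_Ω φ(x, |∇w(x)|) dx < ∞ and G(w) < 0. Moreover one may additionally arrange either that ω is bounded (choosing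 0 ≤ α < β) or that 1/ω is bounded (choosing α < β ≤ 0). -/

import Mathlib

open MeasureTheory Set Metric Filter
open scoped RealInnerProductSpace ENNReal NNReal Topology

noncomputable section

/-- `ℝ^d` with the Euclidean structure. -/
abbrev E (d : ℕ) := EuclideanSpace ℝ (Fin d)

/-- The open cube `Ω = (-1,1)^m`. -/
def cube (m : ℕ) : Set (E m) := {x | ∀ i, x i ∈ Set.Ioo (-1:ℝ) 1}

/-- `w ∈ W_0^{1,1}(Ω)` for `Ω = (−1,1)^d`, with weak gradient `g`: `w` and `g` are
integrable on `Ω` and the extension of `w` by zero has weak gradient (the extension of)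
`g` on `ℝ^d`, i.e. `∫_Ω w ∂_i ξ dx = −∫_Ω g_i ξ dx` for all `ξ ∈ C_c^∞(ℝ^d)`. -/
def MemW011 (d : ℕ) (w : E d → ℝ) (g : E d → E d) : Prop :=
  IntegrableOn w (cube d) volume ∧ IntegrableOn g (cube d) volume ∧
  ∀ ξ : E d → ℝ, ContDiff ℝ (⊤ : ℕ∞) ξ → HasCompactSupport ξ → ∀ i : Fin d,
    ∫ x in cube d, w x * fderiv ℝ ξ x (EuclideanSpace.single i 1) =
      - ∫ x in cube d, g x i * ξ x

/-- The last coordinate `x_d` of `x ∈ ℝ^d`. -/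
def xd (d : ℕ) (x : E d) : ℝ := if h : 0 < d then x ⟨d - 1, Nat.sub_lt h one_pos⟩ else 0

/-- The Euclidean norm `|x̄|` of the first `d-1` coordinates of `x ∈ ℝ^d`. -/
def barNorm (d : ℕ) (x : E d) : ℝ :=
  Real.sqrt (∑ i : Fin d, if (i : ℕ) < d - 1 then (x i)^2 else 0)

/-- The conclusion of the weighted `p`-energy example, with an extra requirement
`extra α β ω` on the data (used to additionally arrange `ω` or `1/ω` bounded).
There are exponents `α < β` lying either in `(−1/p, 1/p′)` with comparison weights
`ω⁻ = ε|x_d|^β ≤ ω ≤ |x_d|^α = ω⁺`, or in `(−(d−1)/p, (d−1)/p′)` with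
`ω⁻ = ε|x̄|^β ≤ ω ≤ |x̄|^α = ω⁺` (power weights whose `p`-th powers are Muckenhoupt
`A_p` weights), `ε > 0`, a measurable weight `ω ≥ 0`, and a compactly supported
`b° ∈ L^1(Ω;ℝ^d)` with `∫_Ω (|b°|/ω)^{p′} dx < ∞`, such that with
`φ(x,t) = (ω(x)t)^p/p`: (i) `∫_Ω b°·∇v dx = 0` for every `v ∈ C^∞(Ω)`, hence
`G(v) = ∫_Ω φ(x,|∇v|) dx + ∫_Ω b°·∇v dx ≥ 0` for every `v ∈ C_c^∞(Ω)`;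
(ii) there is `w ∈ W_0^{1,1}(Ω)` with `∫_Ω φ(x,|∇w|) dx < ∞` and `G(w) < 0`. -/
def WeightedGapExample (d : ℕ) (p : ℝ) (extra : ℝ → ℝ → (E d → ℝ) → Prop) : Prop :=
  ∃ (α β ε : ℝ) (ω : E d → ℝ) (b0 : E d → E d),
    α < β ∧ 0 < ε ∧ Measurable ω ∧ (∀ x, 0 ≤ ω x) ∧ extra α β ω ∧
    ((α ∈ Set.Ioo (-(1/p)) (1 - 1/p) ∧ β ∈ Set.Ioo (-(1/p)) (1 - 1/p) ∧
        ∀ x ∈ cube d, ε * |xd d x| ^ β ≤ ω x ∧ ω x ≤ |xd d x| ^ α) ∨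
      (α ∈ Set.Ioo (-(((d:ℝ) - 1)/p)) (((d:ℝ) - 1) * (1 - 1/p)) ∧
        β ∈ Set.Ioo (-(((d:ℝ) - 1)/p)) (((d:ℝ) - 1) * (1 - 1/p)) ∧
        ∀ x ∈ cube d, ε * barNorm d x ^ β ≤ ω x ∧ ω x ≤ barNorm d x ^ α)) ∧
    IntegrableOn b0 (cube d) volume ∧
    (∃ K : Set (E d), IsCompact K ∧ K ⊆ cube d ∧ ∀ x ∉ K, b0 x = 0) ∧
    IntegrableOn (fun x => (‖b0 x‖ / ω x) ^ (p / (p - 1))) (cube d) volume ∧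
    (∀ v : E d → ℝ, ContDiffOn ℝ (⊤ : ℕ∞) v (cube d) →
      ∫ x in cube d, ⟪b0 x, gradient v x⟫ = 0) ∧
    (∀ v : E d → ℝ, ContDiff ℝ (⊤ : ℕ∞) v → HasCompactSupport v → tsupport v ⊆ cube d →
      0 ≤ (∫ x in cube d, (ω x * ‖gradient v x‖) ^ p / p) +
            ∫ x in cube d, ⟪b0 x, gradient v x⟫) ∧
    (∃ (w : E d → ℝ) (g : E d → E d), MemW011 d w g ∧
      IntegrableOn (fun x => (ω x * ‖g x‖) ^ p / p) (cube d) volume ∧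
      (∫ x in cube d, (ω x * ‖g x‖) ^ p / p) + (∫ x in cube d, ⟪b0 x, g x⟫) < 0)




/-- Iterates approximating the Cantor function with contraction ratio `l`. -/
def cit (l : ℝ) : ℕ → ℝ → ℝ
  | 0 => fun x => if 1 ≤ x then 1 else 0
  | n + 1 => fun x => if x ≤ 1/2 then cit l n (x / l) / 2 else 1/2 + cit l n ((x - 1 + l) / l) / 2

lemma cit_bd (l : ℝ) (n : ℕ) : ∀ x, 0 ≤ cit l n x ∧ cit l n x ≤ 1 := by
  induction n with
  | zero => intro x; simp only [cit]; split_ifs <;> norm_num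
  | succ n ih =>
    intro x; simp only [cit]
    have h1 := ih (x / l); have h2 := ih ((x - 1 + l) / l)
    split_ifs <;> constructor <;> linarith

lemma cit_mono {l : ℝ} (hl : 0 < l) (n : ℕ) : Monotone (cit l n) := by
  induction n with
  | zero =>
    intro x y h; simp only [cit]
    split_ifs <;> linarith
  | succ n ih =>
    intro x y h; simp only [cit]
    have h1 := cit_bd l n (x / l); have h2 := cit_bd l n ((y - 1 + l) / l)
    have h3 : cit l n (x / l) ≤ cit l n (y / l) := ih (by gcongr)
    have h4 : cit l n ((x - 1 + l) / l) ≤ cit l n ((y - 1 + l) / l) := ih (by gcongr)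
    split_ifs <;> first | linarith | (exfalso; linarith)

lemma cit_zero {l : ℝ} (hl : 0 < l) (n : ℕ) : ∀ x ≤ 0, cit l n x = 0 := by
  induction n with
  | zero => intro x h; simp only [cit]; rw [if_neg (by linarith)]
  | succ n ih =>
    intro x h; simp only [cit]; rw [if_pos (by linarith), ih _ (div_nonpos_of_nonpos_of_nonneg h hl.le)]
    norm_num

lemma cit_one {l : ℝ} (hl : 0 < l) (n : ℕ) : ∀ x, 1 ≤ x → cit l n x = 1 := by
  induction n with
  | zero => intro x h; simp only [cit]; rw [if_pos h]
  | succ n ih =>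
    intro x h; simp only [cit]
    rw [if_neg (by linarith), ih _ (by rw [le_div_iff₀ hl]; linarith)]
    norm_num

lemma cit_succ_le {l : ℝ} (hl : 0 < l) (n : ℕ) : ∀ x, cit l n x ≤ cit l (n+1) x := by
  induction n with
  | zero =>
    intro x
    by_cases h : 1 ≤ x
    · rw [cit_one hl _ _ h, cit_one hl _ _ h]
    · have : cit l 0 x = 0 := by simp only [cit]; rw [if_neg h]
      rw [this]; exact (cit_bd l _ x).1
  | succ n ih =>
    intro x
    rw [cit, cit]; beta_reduce
    have h1 := ih (x / l); have h2 := ih ((x - 1 + l) / l)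
    split_ifs <;> linarith

/-- The Cantor function. -/
def cant (l : ℝ) (x : ℝ) : ℝ := ⨆ n, cit l n x

lemma cant_tendsto {l : ℝ} (hl : 0 < l) (x : ℝ) :
    Tendsto (fun n => cit l n x) atTop (𝓝 (cant l x)) :=
  tendsto_atTop_ciSup (monotone_nat_of_le_succ fun n => cit_succ_le hl n x)
    ⟨1, by rintro _ ⟨n, rfl⟩; exact (cit_bd l n x).2⟩

lemma cant_mono {l : ℝ} (hl : 0 < l) : Monotone (cant l) := fun x y h =>
  le_of_tendsto_of_tendsto' (cant_tendsto hl x) (cant_tendsto hl y) fun n => cit_mono hl n h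

lemma cant_bd {l : ℝ} (hl : 0 < l) (x : ℝ) : 0 ≤ cant l x ∧ cant l x ≤ 1 :=
  ⟨ge_of_tendsto' (cant_tendsto hl x) fun n => (cit_bd l n x).1,
    le_of_tendsto' (cant_tendsto hl x) fun n => (cit_bd l n x).2⟩

lemma cant_zero {l : ℝ} (hl : 0 < l) {x : ℝ} (h : x ≤ 0) : cant l x = 0 := by
  simp [cant, cit_zero hl _ _ h]

lemma cant_one {l : ℝ} (hl : 0 < l) {x : ℝ} (h : 1 ≤ x) : cant l x = 1 := by
  simp [cant, cit_one hl _ _ h]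

lemma cant_left {l : ℝ} (hl : 0 < l) {x : ℝ} (h : x ≤ 1/2) : cant l x = cant l (x / l) / 2 := by
  refine tendsto_nhds_unique ((cant_tendsto hl x).comp (tendsto_add_atTop_nat 1)) ?_
  refine ((cant_tendsto hl (x / l)).div_const 2).congr fun n => ?_
  simp only [Function.comp]; rw [cit]; beta_reduce; rw [if_pos h]

lemma cant_right' {l : ℝ} (hl : 0 < l) {x : ℝ} (h : 1/2 < x) :
    cant l x = 1/2 + cant l ((x - 1 + l) / l) / 2 := by
  refine tendsto_nhds_unique ((cant_tendsto hl x).comp (tendsto_add_atTop_nat 1)) ?_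
  refine (((cant_tendsto hl ((x - 1 + l) / l)).div_const 2).const_add (1/2)).congr fun n => ?_
  simp only [Function.comp]; rw [cit]; beta_reduce; rw [if_neg (by linarith)]

lemma cant_left_le {l : ℝ} (hl : 0 < l) (hl2 : l < 1/2) {x : ℝ} (h : x ≤ 1 - l) :
    cant l x = cant l (x / l) / 2 := by
  by_cases h2 : x ≤ 1/2
  · exact cant_left hl h2
  · push Not at h2
    rw [cant_right' hl h2, cant_zero hl (div_nonpos_of_nonpos_of_nonneg (by linarith) hl.le),
      cant_one hl (x := x / l) (by rw [le_div_iff₀ hl]; linarith)]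
    norm_num

lemma cant_right {l : ℝ} (hl : 0 < l) (hl2 : l < 1/2) {x : ℝ} (h : l ≤ x) :
    cant l x = 1/2 + cant l ((x - 1 + l) / l) / 2 := by
  by_cases h2 : x ≤ 1/2
  · rw [cant_left hl h2, cant_zero hl (x := (x-1+l)/l) (div_nonpos_of_nonpos_of_nonneg (by linarith) hl.le),
      cant_one hl (x := x / l) (by rw [le_div_iff₀ hl]; linarith)]
    norm_num
  · exact cant_right' hl (by linarith)

lemma cant_ge {l : ℝ} (hl : 0 < l) (hl2 : l < 1/2) (x : ℝ) : cant l (x / l) / 2 ≤ cant l x := by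
  by_cases h : x ≤ 1 - l
  · rw [cant_left_le hl hl2 h]
  · rw [cant_right hl hl2 (x := x) (by linarith)]
    have := (cant_bd hl (x / l)).2; have := (cant_bd hl ((x-1+l) / l)).1; linarith

lemma cant_le {l : ℝ} (hl : 0 < l) (hl2 : l < 1/2) (x : ℝ) :
    cant l x ≤ 1/2 + cant l ((x - 1 + l) / l) / 2 := by
  by_cases h : l ≤ x
  · rw [cant_right hl hl2 h]
  · rw [cant_left_le hl hl2 (x := x) (by linarith)]
    have := (cant_bd hl (x / l)).2; have := (cant_bd hl ((x-1+l) / l)).1; linarith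

lemma cant_pos {l : ℝ} (hl : 0 < l) (hl2 : l < 1/2) {x : ℝ} (hx : 0 < x) : 0 < cant l x := by
  have key : ∀ n : ℕ, ∀ x, l ^ n ≤ x → 0 < cant l x := by
    intro n
    induction n with
    | zero => intro x h; rw [cant_one hl (by simpa using h)]; norm_num
    | succ n ih =>
      intro x h
      have := ih (x / l) (by rw [le_div_iff₀ hl, ← pow_succ]; exact h)
      have := cant_ge hl hl2 x; linarith
  obtain ⟨n, hn⟩ := exists_pow_lt_of_lt_one hx (show l < 1 by linarith)
  exact key n x hn.le

lemma cant_up {l D : ℝ} (hl : 0 < l) (hl2 : l < 1/2) (hlD : l ^ D = 1/2) {x y : ℝ}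
    (hxy : x < y) (hD : 0 < D) : cant l y - cant l x ≤ ((1 - 2 * l) ^ D)⁻¹ * (y - x) ^ D := by
  have hg : 0 < 1 - 2 * l := by linarith
  have key : ∀ n : ℕ, ∀ x y, x < y → (1 - 2 * l) * l ^ n ≤ y - x →
      cant l y - cant l x ≤ ((1 - 2 * l) ^ D)⁻¹ * (y - x) ^ D := by
    intro n
    induction n with
    | zero =>
      intro x y hxy h
      have h1 := (cant_bd hl x).1; have h2 := (cant_bd hl y).2
      have h3 : (1 - 2 * l) ^ D ≤ (y - x) ^ D := Real.rpow_le_rpow hg.le (by simpa using h) hD.le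
      have h4 : 0 < (1 - 2 * l) ^ D := Real.rpow_pos_of_pos hg _
      have h5 : 1 ≤ ((1 - 2 * l) ^ D)⁻¹ * (y - x) ^ D := by
        rw [inv_mul_eq_div, le_div_iff₀ h4]; linarith
      linarith
    | succ n ih =>
      intro x y hxy h
      by_cases hb : 1 - 2 * l ≤ y - x
      · have h1 := (cant_bd hl x).1; have h2 := (cant_bd hl y).2
        have h3 : (1 - 2 * l) ^ D ≤ (y - x) ^ D := Real.rpow_le_rpow hg.le hb hD.le
        have h4 : 0 < (1 - 2 * l) ^ D := Real.rpow_pos_of_pos hg _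
        have h5 : 1 ≤ ((1 - 2 * l) ^ D)⁻¹ * (y - x) ^ D := by
          rw [inv_mul_eq_div, le_div_iff₀ h4]; linarith
        linarith
      push Not at hb
      have hs : ∀ x' y', y' - x' = (y - x) / l →
          cant l y' - cant l x' ≤ 2 * (((1 - 2 * l) ^ D)⁻¹ * (y - x) ^ D) := by
        intro x' y' he
        have h0 : 0 < (y - x) / l := div_pos (by linarith) hl
        refine (ih x' y' (by linarith) ?_).trans ?_
        · rw [he, le_div_iff₀ hl]; rw [pow_succ] at h; linarith
        · rw [he, Real.div_rpow (by linarith) hl.le, hlD]; apply le_of_eq; ring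
      by_cases hx : x < l
      · rw [cant_left_le hl hl2 (x := x) (by linarith), cant_left_le hl hl2 (x := y) (by linarith)]
        have := hs (x / l) (y / l) (by ring)
        linarith
      · rw [cant_right hl hl2 (x := x) (by linarith), cant_right hl hl2 (x := y) (by linarith)]
        have := hs ((x - 1 + l) / l) ((y - 1 + l) / l) (by ring)
        linarith
  obtain ⟨n, hn⟩ := exists_pow_lt_of_lt_one (div_pos (sub_pos.2 hxy) hg) (show l < 1 by linarith)
  refine key n x y hxy ?_
  rw [lt_div_iff₀ hg] at hn; linarith

lemma cant_low {l : ℝ} (hl : 0 < l) (hl2 : l < 1/2) (n : ℕ) : ∀ x y e, cant l x < cant l y →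
    l ^ n ≤ e → (1/2:ℝ) ^ n ≤ cant l (y + e) - cant l (x - e) := by
  induction n with
  | zero =>
    intro x y e h he
    have hy : 0 < y := by
      by_contra hc; rw [cant_zero hl (not_lt.1 hc)] at h; linarith [(cant_bd hl x).1]
    have hx : x < 1 := by
      by_contra hc; rw [cant_one hl (not_lt.1 hc)] at h; linarith [(cant_bd hl y).2]
    simp only [pow_zero] at he ⊢
    rw [cant_one hl (by linarith), cant_zero hl (by linarith)]; norm_num
  | succ n ih =>
    intro x y e h he
    have he' : l ^ n ≤ e / l := by rw [le_div_iff₀ hl, ← pow_succ]; exact he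
    have hepos : 0 < e := lt_of_lt_of_le (by positivity) he
    have hxy : x < y := by
      by_contra hc; exact absurd (cant_mono hl (not_lt.1 hc)) (not_le.2 h)
    by_cases hc : cant l (min x (1/2)) < cant l (min y (1/2))
    · have hx : x < 1/2 := by
        by_contra hc2
        rw [min_eq_right (not_lt.1 hc2), min_eq_right (by linarith)] at hc; exact lt_irrefl _ hc
      rw [min_eq_left hx.le, cant_left hl hx.le, cant_left hl (min_le_right _ _)] at hc
      have h1 := ih (x / l) (min y (1/2) / l) (e / l) (by linarith) he'
      have h2 := cant_ge hl hl2 (y + e)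
      have h3 : cant l (min y (1/2) / l + e / l) ≤ cant l ((y + e) / l) := by
        apply cant_mono hl; rw [← add_div]; gcongr; exact min_le_left _ _
      rw [cant_left hl (x := x - e) (by linarith), sub_div, pow_succ]
      linarith
    · have hc' : cant l (max x (1/2)) < cant l (max y (1/2)) := by
        rcases le_total x (1/2) with h1 | h1
        · rw [max_eq_right h1]
          rw [min_eq_left h1] at hc
          rcases le_total y (1/2) with h2 | h2
          · rw [min_eq_left h2] at hc; exact absurd h hc
          · rw [max_eq_left h2]; rw [min_eq_right h2] at hc; linarith
        · rw [max_eq_left h1, max_eq_left (by linarith)]; exact h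
      have hy : 1/2 < y := by
        by_contra hc2
        rw [max_eq_right (not_lt.1 hc2), max_eq_right (by linarith)] at hc'; exact lt_irrefl _ hc'
      rw [max_eq_left hy.le, cant_right hl hl2 (x := y) (by linarith),
        cant_right hl hl2 (x := max x (1/2)) (by linarith [le_max_right x (1/2)])] at hc'
      have h1 := ih ((max x (1/2) - 1 + l) / l) ((y - 1 + l) / l) (e / l) (by linarith) he'
      have h2 := cant_le hl hl2 (x - e)
      have h3 : cant l ((x - e - 1 + l) / l) ≤ cant l ((max x (1/2) - 1 + l) / l - e / l) := by
        apply cant_mono hl; rw [← sub_div]; gcongr; linarith [le_max_left x (1/2)]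
      rw [cant_right hl hl2 (x := y + e) (by linarith),
        show (y + e - 1 + l) / l = (y - 1 + l) / l + e / l by ring, pow_succ]
      linarith

/-- Cantor-type function of dimension `D`. -/
structure CF (D C c : ℝ) (F : ℝ → ℝ) : Prop where
  D0 : 0 < D
  D1 : D < 1
  C0 : 0 < C
  c0 : 0 < c
  mono : Monotone F
  cont : Continuous F
  zero : ∀ s ≤ 0, F s = 0
  one : ∀ s, 1/4 ≤ s → F s = 1
  pos : ∀ s, 0 < s → 0 < F s
  up : ∀ s t, 0 < t → F (s + t) - F (s - t) ≤ C * t ^ D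
  low : ∀ s t, 0 < t → t ≤ 1 → F (s - t) < F (s + t) → c * t ^ D ≤ F (s + 2 * t) - F (s - 2 * t)

lemma exists_CF {D : ℝ} (hD : 0 < D) (hD1 : D < 1) : ∃ C c F, CF D C c F := by
  set l : ℝ := (1/2) ^ (1/D) with hldef
  have hl : 0 < l := by positivity
  have hl2 : l < 1/2 := by
    have := Real.rpow_lt_rpow_of_exponent_gt (x := 1/2) (by norm_num) (by norm_num)
      (show 1 < 1/D by rw [lt_div_iff₀ hD]; linarith)
    rwa [Real.rpow_one] at this
  have hlD : l ^ D = 1/2 := by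
    rw [hldef, ← Real.rpow_mul (by norm_num), one_div_mul_cancel hD.ne', Real.rpow_one]
  have hg : 0 < 1 - 2 * l := by linarith
  set A := ((1 - 2 * l) ^ D)⁻¹ with hA
  have hA0 : 0 < A := by positivity
  have hup : ∀ x y, x < y → cant l y - cant l x ≤ A * (y - x) ^ D :=
    fun x y h => cant_up hl hl2 hlD h hD
  have hcont : Continuous (cant l) := by
    rw [Metric.continuous_iff]
    intro x ε hε
    have ht : Tendsto (fun t : ℝ => A * t ^ D) (𝓝 0) (𝓝 0) := by
      have : ContinuousAt (fun t : ℝ => A * t ^ D) 0 :=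
        (Real.continuousAt_rpow_const _ _ (Or.inr hD.le)).const_mul A
      have h2 := this.tendsto
      simpa [Real.zero_rpow hD.ne'] using h2
    obtain ⟨δ, hδ, h⟩ := Metric.eventually_nhds_iff.1 (ht.eventually (gt_mem_nhds hε))
    refine ⟨δ, hδ, fun y hy => ?_⟩
    rw [Real.dist_eq] at hy ⊢
    rcases lt_trichotomy x y with hxy | hxy | hxy
    · have h1 := hup x y hxy
      have h2 := cant_mono hl hxy.le
      have h3 := h (y := y - x) (by rw [Real.dist_eq, sub_zero]; exact hy)
      rw [abs_of_nonneg (by linarith)]; linarith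
    · subst hxy; simpa using hε
    · have h1 := hup y x hxy
      have h2 := cant_mono hl hxy.le
      have h3 := h (y := x - y) (by rw [Real.dist_eq, sub_zero, abs_sub_comm]; exact hy)
      rw [abs_of_nonpos (by linarith)]; linarith
  refine ⟨A * 8 ^ D, 1/2, fun s => cant l (4 * s), hD, hD1, by positivity, by positivity,
    fun x y h => cant_mono hl (by linarith), hcont.comp (by fun_prop),
    fun s hs => cant_zero hl (by linarith), fun s hs => cant_one hl (by linarith),
    fun s hs => cant_pos hl hl2 (by linarith), ?_, ?_⟩
  · intro s t ht
    refine (hup _ _ (by linarith)).trans (le_of_eq ?_)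
    rw [show 4 * (s + t) - 4 * (s - t) = 8 * t by ring, Real.mul_rpow (by norm_num) ht.le]; ring
  · intro s t ht ht1 h
    obtain ⟨n, hn1, hn2⟩ : ∃ n : ℕ, l ^ (n + 1) ≤ t ∧ t ≤ l ^ n := by
      obtain ⟨n, h1, h2⟩ := exists_nat_pow_near_of_lt_one ht ht1 hl (by linarith)
      exact ⟨n, h1.le, h2⟩
    have h1 := cant_low hl hl2 (n + 1) _ _ (4 * t) h (by linarith)
    rw [show 4 * (s + 2 * t) = 4 * (s + t) + 4 * t by ring,
      show 4 * (s - 2 * t) = 4 * (s - t) - 4 * t by ring]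
    refine le_trans ?_ h1
    have h3 : t ^ D ≤ (1/2) ^ n := by
      refine (Real.rpow_le_rpow ht.le hn2 hD.le).trans (le_of_eq ?_)
      rw [← Real.rpow_natCast, ← Real.rpow_mul hl.le, mul_comm, Real.rpow_mul hl.le, hlD,
        Real.rpow_natCast]
    rw [pow_succ]; linarith



/-- Primitive of `F`. -/
def Hf (F : ℝ → ℝ) (s : ℝ) : ℝ := ∫ x in (0:ℝ)..s, F x

lemma Hf_deriv {F : ℝ → ℝ} (hF : Continuous F) (s : ℝ) : HasDerivAt (Hf F) (F s) s :=
  intervalIntegral.integral_hasDerivAt_right (hF.intervalIntegrable _ _)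
    hF.stronglyMeasurable.stronglyMeasurableAtFilter hF.continuousAt

lemma Hf_bd {F : ℝ → ℝ} (hF : Continuous F) (hm : Monotone F) {a b : ℝ} (h : a ≤ b) :
    F a * (b - a) ≤ Hf F b - Hf F a ∧ Hf F b - Hf F a ≤ F b * (b - a) := by
  have e : Hf F b - Hf F a = ∫ x in a..b, F x := by
    unfold Hf
    rw [intervalIntegral.integral_interval_sub_left] <;> exact hF.intervalIntegrable _ _
  rw [e]
  constructor
  · have := intervalIntegral.integral_mono_on h (intervalIntegrable_const (c := F a) (μ := volume))
      (hF.intervalIntegrable a b) (fun x hx => hm hx.1)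
    simp only [intervalIntegral.integral_const, smul_eq_mul] at this
    linarith
  · have := intervalIntegral.integral_mono_on h (hF.intervalIntegrable a b)
      (intervalIntegrable_const (c := F b) (μ := volume)) (fun x hx => hm hx.2)
    simp only [intervalIntegral.integral_const, smul_eq_mul] at this
    linarith

def pz (F : ℝ → ℝ) (s r : ℝ) : ℝ := (Hf F (s + r) - Hf F (s - r)) / (2 * r)

lemma pz_mem {F : ℝ → ℝ} (hF : Continuous F) (hm : Monotone F) {s r : ℝ} (h : 0 < r) :
    F (s - r) ≤ pz F s r ∧ pz F s r ≤ F (s + r) := by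
  have := Hf_bd hF hm (show s - r ≤ s + r by linarith)
  unfold pz
  rw [le_div_iff₀ (by linarith), div_le_iff₀ (by linarith)]
  constructor <;> linarith

lemma pz_deriv {V : Type*} [NormedAddCommGroup V] [NormedSpace ℝ V] {F : ℝ → ℝ} (hF : Continuous F)
    (hm : Monotone F) {a rr : V → ℝ} {a' r' : V →L[ℝ] ℝ} {x : V} (ha : HasFDerivAt a a' x)
    (hr : HasFDerivAt rr r' x) (h : 0 < rr x) :
    ∃ B : ℝ, HasFDerivAt (fun y => pz F (a y) (rr y))
      (((F (a x + rr x) - F (a x - rr x)) / (2 * rr x)) • a' + B • r') x ∧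
      |B| ≤ (F (a x + rr x) - F (a x - rr x)) / (2 * rr x) := by
  set s := a x
  set r := rr x
  refine ⟨((F (s + r) + F (s - r)) / 2 - pz F s r) / r, ?_, ?_⟩
  · have h1 := (Hf_deriv hF (s + r)).comp_hasFDerivAt x (ha.add hr)
    have h2 := (Hf_deriv hF (s - r)).comp_hasFDerivAt x (ha.sub hr)
    have h3 := (hasDerivAt_inv (x := 2 * r) (by positivity)).comp_hasFDerivAt x (hr.const_mul 2)
    have h4 := (h1.sub h2).mul h3
    unfold pz
    simp only [div_eq_mul_inv]
    refine h4.congr_fderiv ?_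
    ext v
    have er : rr x = r := rfl
    have es : a x = s := rfl
    simp [er, es]
    field_simp
    ring
  · have := pz_mem hF hm (s := s) h
    rw [abs_div, abs_of_pos h, div_le_div_iff₀ h (by linarith)]
    have : |(F (s + r) + F (s - r)) / 2 - pz F s r| ≤ (F (s + r) - F (s - r)) / 2 := by
      rw [abs_le]; constructor <;> linarith
    nlinarith

def qz (F : ℝ → ℝ) (s r : ℝ) : ℝ :=
  (Hf F (s + 3 * r) - Hf F (s + 2 * r) - (Hf F (s - 2 * r) - Hf F (s - 3 * r))) / r

lemma qz_mem {F : ℝ → ℝ} (hF : Continuous F) (hm : Monotone F) {s r : ℝ} (h : 0 < r) :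
    F (s + 2 * r) - F (s - 2 * r) ≤ qz F s r ∧ qz F s r ≤ F (s + 3 * r) - F (s - 3 * r) := by
  have h1 := Hf_bd hF hm (show s + 2 * r ≤ s + 3 * r by linarith)
  have h2 := Hf_bd hF hm (show s - 3 * r ≤ s - 2 * r by linarith)
  unfold qz
  rw [le_div_iff₀ h, div_le_iff₀ h]
  constructor <;> linarith

lemma qz_deriv {V : Type*} [NormedAddCommGroup V] [NormedSpace ℝ V] {F : ℝ → ℝ} (hF : Continuous F)
    (hm : Monotone F) {a rr : V → ℝ} {a' r' : V →L[ℝ] ℝ} {x : V} (ha : HasFDerivAt a a' x)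
    (hr : HasFDerivAt rr r' x) (h : 0 < rr x) :
    ∃ A B : ℝ, HasFDerivAt (fun y => qz F (a y) (rr y)) (A • a' + B • r') x ∧
      |A| ≤ (F (a x + 3 * rr x) - F (a x - 3 * rr x)) / rr x ∧
      |B| ≤ 4 * (F (a x + 3 * rr x) - F (a x - 3 * rr x)) / rr x := by
  set s := a x
  set r := rr x
  have m1 : F (s - 3 * r) ≤ F (s - 2 * r) := hm (by linarith)
  have m2 : F (s - 2 * r) ≤ F (s + 2 * r) := hm (by linarith)
  have m3 : F (s + 2 * r) ≤ F (s + 3 * r) := hm (by linarith)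
  refine ⟨(F (s + 3 * r) - F (s + 2 * r) - (F (s - 2 * r) - F (s - 3 * r))) / r,
    ((3 * F (s + 3 * r) - 2 * F (s + 2 * r) + 2 * F (s - 2 * r) - 3 * F (s - 3 * r))
      - qz F s r) / r, ?_, ?_, ?_⟩
  · have h1 := (Hf_deriv hF (s + 3 * r)).comp_hasFDerivAt x (ha.add (hr.const_mul 3))
    have h2 := (Hf_deriv hF (s + 2 * r)).comp_hasFDerivAt x (ha.add (hr.const_mul 2))
    have h3 := (Hf_deriv hF (s - 2 * r)).comp_hasFDerivAt x (ha.sub (hr.const_mul 2))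
    have h4 := (Hf_deriv hF (s - 3 * r)).comp_hasFDerivAt x (ha.sub (hr.const_mul 3))
    have h5 := (hasDerivAt_inv (x := r) h.ne').comp_hasFDerivAt x hr
    have h6 := ((h1.sub h2).sub (h3.sub h4)).mul h5
    unfold qz
    simp only [div_eq_mul_inv]
    refine h6.congr_fderiv ?_
    ext v
    have er : rr x = r := rfl
    have es : a x = s := rfl
    simp [er, es]
    field_simp
    ring
  · rw [abs_div, abs_of_pos h]
    gcongr
    rw [abs_le]; constructor <;> linarith
  · have := qz_mem hF hm (s := s) h
    rw [abs_div, abs_of_pos h]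
    gcongr
    rw [abs_le]; constructor <;> linarith

lemma hst_deriv_bd : ∃ M : ℝ, 0 < M ∧ ∀ x, |deriv Real.smoothTransition x| ≤ M := by
  have hc : Continuous (deriv Real.smoothTransition) :=
    (Real.smoothTransition.contDiff (n := 1)).continuous_deriv le_rfl
  have hs : HasCompactSupport (deriv Real.smoothTransition) := by
    refine HasCompactSupport.of_support_subset_isCompact (isCompact_Icc (a := (0:ℝ)) (b := 1)) ?_
    intro x hx
    by_contra hcon
    apply hx
    rw [mem_Icc, not_and_or, not_le, not_le] at hcon
    rcases hcon with h | h
    · have : Real.smoothTransition =ᶠ[𝓝 x] fun _ => 0 := by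
        filter_upwards [gt_mem_nhds h] with y hy using Real.smoothTransition.zero_of_nonpos hy.le
      rw [this.deriv_eq]; simp
    · have : Real.smoothTransition =ᶠ[𝓝 x] fun _ => 1 := by
        filter_upwards [lt_mem_nhds h] with y hy using Real.smoothTransition.one_of_one_le hy.le
      rw [this.deriv_eq]; simp
  obtain ⟨M, hM⟩ := hc.bounded_above_of_compact_support hs
  refine ⟨max M 1, by positivity, fun x => le_max_of_le_left ?_⟩
  simpa using hM x

lemma hst_hasDeriv (x : ℝ) :
    HasDerivAt Real.smoothTransition (deriv Real.smoothTransition x) x :=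
  ((Real.smoothTransition.contDiff (n := 1)).differentiable (by norm_num)).differentiableAt.hasDerivAt

def th (D c : ℝ) (F : ℝ → ℝ) (s r : ℝ) : ℝ :=
  Real.smoothTransition (c⁻¹ * (r ^ (-D) * qz F s r))

lemma th_one {D C c : ℝ} {F : ℝ → ℝ} (hF : CF D C c F) {s r : ℝ} (h : 0 < r) (h1 : r ≤ 1)
    (h2 : F (s - r) < F (s + r)) : th D c F s r = 1 := by
  apply Real.smoothTransition.one_of_one_le
  have h3 := hF.low s r h h1 h2
  have h4 := (qz_mem hF.cont hF.mono (s := s) h).1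
  rw [Real.rpow_neg h.le, le_inv_mul_iff₀ hF.c0, le_inv_mul_iff₀ (by positivity)]
  linarith

lemma th_zero {D C c : ℝ} {F : ℝ → ℝ} (hF : CF D C c F) {s r : ℝ} (h : 0 < r)
    (h2 : ¬ F (s - 3 * r) < F (s + 3 * r)) : th D c F s r = 0 := by
  apply Real.smoothTransition.zero_of_nonpos
  have h4 := (qz_mem hF.cont hF.mono (s := s) h).2
  have : qz F s r ≤ 0 := by linarith
  have h5 : 0 < c⁻¹ := inv_pos.2 hF.c0
  have h6 : 0 < r ^ (-D) := by positivity
  exact mul_nonpos_of_nonneg_of_nonpos h5.le (mul_nonpos_of_nonneg_of_nonpos h6.le this)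

lemma th_deriv {D C c : ℝ} {F : ℝ → ℝ} (hF : CF D C c F) : ∃ K : ℝ, 0 < K ∧
    ∀ {V : Type} [NormedAddCommGroup V] [NormedSpace ℝ V]
    {a rr : V → ℝ} {a' r' : V →L[ℝ] ℝ} {x : V} (_ : HasFDerivAt a a' x)
    (_ : HasFDerivAt rr r' x) (_ : 0 < rr x),
    ∃ A B : ℝ, HasFDerivAt (fun y => th D c F (a y) (rr y)) (A • a' + B • r') x ∧
      |A| ≤ K / rr x ∧ |B| ≤ K / rr x ∧
      (¬ F (a x - 3 * rr x) < F (a x + 3 * rr x) → A = 0 ∧ B = 0) := by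
  obtain ⟨M, hM, hMb⟩ := hst_deriv_bd
  have hD := hF.D0
  have hc := hF.c0
  have hC := hF.C0
  refine ⟨M * (c⁻¹ * ((4 + D) * (C * 3 ^ D))), by positivity, ?_⟩
  intro V _ _ a rr a' r' x ha hr h
  obtain ⟨A, B, hq, hA, hB⟩ := qz_deriv hF.cont hF.mono ha hr h
  set s := a x
  set r := rr x
  set Δ := F (s + 3 * r) - F (s - 3 * r) with hΔ
  have hΔ0 : 0 ≤ Δ := sub_nonneg.2 (hF.mono (by linarith))
  have hΔ1 : Δ ≤ C * 3 ^ D * r ^ D := by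
    have := hF.up s (3 * r) (by linarith)
    rw [Real.mul_rpow (by norm_num) h.le] at this; linarith
  have hp := (Real.hasDerivAt_rpow_const (x := r) (p := -D) (Or.inl h.ne')).comp_hasFDerivAt x hr
  have hz := (hst_hasDeriv (c⁻¹ * (r ^ (-D) * qz F s r))).comp_hasFDerivAt x ((hp.mul hq).const_mul c⁻¹)
  set h' := deriv Real.smoothTransition (c⁻¹ * (r ^ (-D) * qz F s r))
  have hq1 := qz_mem hF.cont hF.mono (s := s) h
  have hq0 : 0 ≤ qz F s r := le_trans (sub_nonneg.2 (hF.mono (by linarith))) hq1.1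
  have hrD : r ^ (-D) * r ^ D = 1 := by rw [← Real.rpow_add h]; simp
  have hrD1 : r ^ (-D - 1) = r ^ (-D) / r := by rw [Real.rpow_sub_one h.ne']
  have hrp : 0 < r ^ (-D) := by positivity
  have hAb : |h' * (c⁻¹ * (r ^ (-D) * A))| ≤ M * (c⁻¹ * (r ^ (-D) * ((4 + D) * Δ / r))) := by
    rw [abs_mul, abs_mul, abs_mul, abs_of_pos (inv_pos.2 hc), abs_of_pos hrp]
    gcongr
    · exact hMb _
    · refine hA.trans ?_
      gcongr
      nlinarith
  have hBb : |h' * (c⁻¹ * (r ^ (-D) * B + qz F s r * (-D * r ^ (-D - 1))))| ≤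
      M * (c⁻¹ * (r ^ (-D) * ((4 + D) * Δ / r))) := by
    rw [hrD1, show r ^ (-D) * B + qz F s r * (-D * (r ^ (-D) / r)) =
      r ^ (-D) * (B - D * qz F s r / r) by ring]
    rw [abs_mul, abs_mul, abs_mul, abs_of_pos (inv_pos.2 hc), abs_of_pos hrp]
    gcongr
    · exact hMb _
    · refine (abs_sub _ _).trans ?_
      rw [abs_of_nonneg (a := D * qz F s r / r) (by positivity)]
      have : D * qz F s r / r ≤ D * Δ / r := by gcongr; exact hq1.2
      calc |B| + D * qz F s r / r ≤ 4 * Δ / r + D * Δ / r := add_le_add hB this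
        _ = _ := by ring
  have hfin : M * (c⁻¹ * (r ^ (-D) * ((4 + D) * Δ / r))) ≤
      M * (c⁻¹ * ((4 + D) * (C * 3 ^ D))) / r := by
    calc M * (c⁻¹ * (r ^ (-D) * ((4 + D) * Δ / r)))
        ≤ M * (c⁻¹ * (r ^ (-D) * ((4 + D) * (C * 3 ^ D * r ^ D) / r))) := by gcongr
      _ = M * (c⁻¹ * ((4 + D) * (C * 3 ^ D))) / r * (r ^ (-D) * r ^ D) := by ring
      _ = _ := by rw [hrD, mul_one]
  refine ⟨h' * (c⁻¹ * (r ^ (-D) * A)),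
    h' * (c⁻¹ * (r ^ (-D) * B + qz F s r * (-D * r ^ (-D - 1)))), ?_, hAb.trans hfin,
    hBb.trans hfin, ?_⟩
  · refine hz.congr_fderiv ?_
    ext v
    simp
    ring
  · intro hn
    have : Δ = 0 := le_antisymm (by linarith) hΔ0
    rw [this] at hAb hBb
    simp only [mul_zero, zero_div] at hAb hBb
    exact ⟨abs_nonpos_iff.1 hAb, abs_nonpos_iff.1 hBb⟩

lemma vol_A {D C c : ℝ} {F : ℝ → ℝ} (hF : CF D C c F) : ∃ K : ℝ, 0 < K ∧ ∀ r, 0 < r →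
    volume ({s | F (s - 3 * r) < F (s + 3 * r)} ∩ Ioo (-1) 1) ≤ ENNReal.ofReal (K * r ^ (1 - D)) := by
  have hc := hF.c0
  have hD1 := hF.D1
  refine ⟨max (4 * 3 ^ (1 - D) / c) (2 * 3 ^ (1 - D)), by positivity, ?_⟩
  intro r hr
  set u := 3 * r with hu
  have hu0 : 0 < u := by positivity
  have hur : u ^ (1 - D) = 3 ^ (1 - D) * r ^ (1 - D) := Real.mul_rpow (by norm_num) hr.le
  have hrp : 0 < r ^ (1 - D) := by positivity
  by_cases h1 : u ≤ 1
  · set A := {s | F (s - u) < F (s + u)} ∩ Ioo (-1:ℝ) 1 with hA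
    have hcont := hF.cont
    have hAm : MeasurableSet A := by
      refine MeasurableSet.inter ?_ measurableSet_Ioo
      exact (isOpen_lt (by fun_prop) (by fun_prop)).measurableSet
    have hfin : volume A ≠ ∞ := by
      refine ne_top_of_le_ne_top ?_ (measure_mono inter_subset_right)
      simp
    have hIntg : ∫ s in (-1:ℝ)..1, (F (s + 2 * u) - F (s - 2 * u)) ≤ 4 * u := by
      rw [intervalIntegral.integral_sub (Continuous.intervalIntegrable (by fun_prop) _ _)
        (Continuous.intervalIntegrable (by fun_prop) _ _),
        intervalIntegral.integral_comp_add_right, intervalIntegral.integral_comp_sub_right]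
      have e : ∀ a b, ∫ x in a..b, F x = Hf F b - Hf F a := by
        intro a b
        unfold Hf
        rw [intervalIntegral.integral_interval_sub_left] <;> exact hcont.intervalIntegrable _ _
      rw [e, e]
      have h2 := (Hf_bd hcont hF.mono (show 1 - 2 * u ≤ 1 + 2 * u by linarith)).2
      have h3 := (Hf_bd hcont hF.mono (show -1 - 2 * u ≤ -1 + 2 * u by linarith)).1
      have h4 := hF.one (1 + 2 * u) (by linarith)
      have h5 := hF.zero (-1 - 2 * u) (by linarith)
      rw [h4] at h2; rw [h5] at h3
      linarith
    rw [intervalIntegral.integral_of_le (by norm_num), integral_Ioc_eq_integral_Ioo] at hIntg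
    have hi : IntegrableOn (fun s => F (s + 2 * u) - F (s - 2 * u)) (Ioo (-1) 1) :=
      (Continuous.integrableOn_Icc (by fun_prop)).mono_set Ioo_subset_Icc_self
    have h6 : ∫ s in A, (c * u ^ D) ≤ 4 * u := by
      refine le_trans ?_ hIntg
      refine le_trans (setIntegral_mono_on ?_ (hi.mono_set inter_subset_right) hAm ?_) ?_
      · exact integrableOn_const hfin
      · intro s hs
        exact hF.low s u hu0 h1 hs.1
      · refine setIntegral_mono_set hi ?_ (Eventually.of_forall inter_subset_right)
        refine Eventually.of_forall fun s => ?_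
        exact sub_nonneg.2 (hF.mono (by linarith))
    rw [setIntegral_const, smul_eq_mul] at h6
    have h7 : volume.real A ≤ 4 * u / (c * u ^ D) := by rw [le_div_iff₀ (by positivity)]; exact h6
    rw [← ENNReal.ofReal_toReal hfin]
    apply ENNReal.ofReal_le_ofReal
    refine h7.trans ?_
    calc 4 * u / (c * u ^ D) = 4 / c * u ^ (1 - D) := by
          rw [Real.rpow_sub hu0, Real.rpow_one]; field_simp
      _ = 4 * 3 ^ (1 - D) / c * r ^ (1 - D) := by rw [hur]; ring
      _ ≤ _ := by gcongr; exact le_max_left _ _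
  · refine (measure_mono inter_subset_right).trans ?_
    rw [Real.volume_Ioo]
    apply ENNReal.ofReal_le_ofReal
    have : 1 ≤ u ^ (1 - D) := Real.one_le_rpow (by linarith) (by linarith)
    calc (1:ℝ) - -1 ≤ 2 * u ^ (1 - D) := by linarith
      _ = 2 * 3 ^ (1 - D) * r ^ (1 - D) := by rw [hur]; ring
      _ ≤ _ := by gcongr; exact le_max_right _ _



/-- Partial derivative. -/
def pd {d : ℕ} (f : E d → ℝ) (i : Fin d) (x : E d) : ℝ := fderiv ℝ f x (EuclideanSpace.single i 1)

/-- Point with `i`-th coordinate `t`, the remaining ones given by `y`. -/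
def ins {n : ℕ} (i : Fin (n+1)) (t : ℝ) (y : Fin n → ℝ) : E (n+1) :=
  WithLp.toLp 2 (i.insertNth t y : Fin (n+1) → ℝ)

@[simp] lemma ins_same {n : ℕ} (i : Fin (n+1)) (t : ℝ) (y : Fin n → ℝ) : ins i t y i = t := by
  simp [ins]

@[simp] lemma ins_succAbove {n : ℕ} (i : Fin (n+1)) (t : ℝ) (y : Fin n → ℝ) (j : Fin n) :
    ins i t y (i.succAbove j) = y j := by
  simp [ins]

/-- slicing equivalence -/
def insE {n : ℕ} (i : Fin (n+1)) : ℝ × (Fin n → ℝ) ≃ᵐ E (n+1) :=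
  (MeasurableEquiv.piFinSuccAbove (fun _ => ℝ) i).symm.trans (MeasurableEquiv.toLp 2 _)

lemma insE_apply {n : ℕ} (i : Fin (n+1)) (z : ℝ × (Fin n → ℝ)) : insE i z = ins i z.1 z.2 := rfl

lemma insE_mp {n : ℕ} (i : Fin (n+1)) : MeasurePreserving (insE i) volume volume := by
  have h1 := (volume_preserving_piFinSuccAbove (fun _ : Fin (n+1) => ℝ) i).symm
  have h2 := PiLp.volume_preserving_toLp (Fin (n+1))
  exact h2.comp h1

lemma ins_eq {n : ℕ} (i : Fin (n+1)) (t : ℝ) (y : Fin n → ℝ) :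
    ins i t y = ins i 0 y + t • EuclideanSpace.single i 1 := by
  ext j
  rcases eq_or_ne j i with rfl | h
  · simp
  · obtain ⟨k, rfl⟩ := Fin.exists_succAbove_eq h
    simp

lemma ins_deriv {n : ℕ} (i : Fin (n+1)) (t : ℝ) (y : Fin n → ℝ) {f : E (n+1) → ℝ}
    (hf : DifferentiableAt ℝ f (ins i t y)) :
    HasDerivAt (fun t => f (ins i t y)) (pd f i (ins i t y)) t := by
  have h1 : HasDerivAt (fun t => ins i t y) (EuclideanSpace.single i (1:ℝ)) t := by
    have : (fun t => ins i t y) = fun t => ins i 0 y + t • EuclideanSpace.single i (1:ℝ) :=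
      funext fun t => ins_eq i t y
    rw [this]
    simpa using ((hasDerivAt_id t).smul_const (EuclideanSpace.single i (1:ℝ))).const_add (ins i 0 y)
  exact hf.hasFDerivAt.comp_hasDerivAt t h1

lemma integral_ins {n : ℕ} (i : Fin (n+1)) {f : E (n+1) → ℝ} (hf : Integrable f) :
    ∫ x, f x = ∫ y, ∫ t, f (ins i t y) := by
  rw [← (insE_mp i).integral_comp (insE i).measurableEmbedding]
  have h2 : Integrable (fun z => f (insE i z)) :=
    ((insE_mp i).integrable_comp_emb (insE i).measurableEmbedding).2 hf
  exact integral_prod_symm _ h2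

lemma integrable_ins {n : ℕ} (i : Fin (n+1)) {f : E (n+1) → ℝ} (hf : Integrable f) :
    ∀ᵐ y, Integrable (fun t => f (ins i t y)) := by
  have h2 : Integrable (fun z => f (insE i z)) :=
    ((insE_mp i).integrable_comp_emb (insE i).measurableEmbedding).2 hf
  exact h2.prod_left_ae

lemma pd_cont {d : ℕ} {ξ : E d → ℝ} (hξ : ContDiff ℝ 1 ξ) (i : Fin d) : Continuous (pd ξ i) :=
  (hξ.continuous_fderiv one_ne_zero).clm_apply continuous_const

lemma pd_supp {d : ℕ} {ξ : E d → ℝ} (hs : HasCompactSupport ξ) (i : Fin d) :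
    HasCompactSupport (pd ξ i) := (hs.fderiv (𝕜 := ℝ)).comp_left 
    (g := fun L : E d →L[ℝ] ℝ => L (EuclideanSpace.single i 1)) (by simp)

lemma int_mul_bdd {d : ℕ} {f g : E d → ℝ} (hf : Integrable f) (hg : Continuous g)
    (hs : HasCompactSupport g) : Integrable (fun x => f x * g x) := by
  obtain ⟨M, hM⟩ := hg.bounded_above_of_compact_support hs
  exact hf.mul_bdd hg.aestronglyMeasurable (Eventually.of_forall hM)

lemma weak_deriv {n : ℕ} {f : E (n+1) → ℝ} {Z : Set (E (n+1))}
    (hZ : ∀ i, ∀ᵐ y, ∀ t, ins i t y ∉ Z) (hd : ∀ x ∉ Z, DifferentiableAt ℝ f x)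
    (hf : Integrable f) (i : Fin (n+1)) (hfi : Integrable (pd f i)) {ξ : E (n+1) → ℝ}
    (hξ : ContDiff ℝ 1 ξ) (hs : HasCompactSupport ξ) :
    ∫ x, f x * pd ξ i x = - ∫ x, pd f i x * ξ x := by
  have h1 := int_mul_bdd hf (pd_cont hξ i) (pd_supp hs i)
  have h2 := int_mul_bdd hfi hξ.continuous hs
  have h3 := int_mul_bdd hf hξ.continuous hs
  rw [integral_ins i h1, integral_ins i h2, ← integral_neg]
  refine integral_congr_ae ?_
  filter_upwards [hZ i, integrable_ins i h1, integrable_ins i h2, integrable_ins i h3]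
    with y hy k1 k2 k3
  exact integral_mul_deriv_eq_deriv_mul_of_integrable
    (u := fun t => f (ins i t y)) (v := fun t => ξ (ins i t y))
    (fun t _ => ins_deriv i t y (hd _ (hy t)))
    (fun t _ => ins_deriv i t y ((hξ.differentiable (by norm_num)).differentiableAt)) k1 k2 k3

/-- Partial Euclidean norm. -/
def rT {d : ℕ} (T : Finset (Fin d)) (x : E d) : ℝ := Real.sqrt (∑ i ∈ T, (x i)^2)

lemma rT_nonneg {d : ℕ} (T : Finset (Fin d)) (x : E d) : 0 ≤ rT T x := Real.sqrt_nonneg _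

lemma rT_sq {d : ℕ} (T : Finset (Fin d)) (x : E d) : rT T x ^ 2 = ∑ i ∈ T, (x i)^2 :=
  Real.sq_sqrt (Finset.sum_nonneg fun _ _ => sq_nonneg _)

lemma rT_cont {d : ℕ} (T : Finset (Fin d)) : Continuous (rT T) := by
  unfold rT; fun_prop

lemma abs_le_rT {d : ℕ} {T : Finset (Fin d)} {i : Fin d} (hi : i ∈ T) (x : E d) : |x i| ≤ rT T x := by
  rw [← Real.sqrt_sq_eq_abs]
  exact Real.sqrt_le_sqrt (Finset.single_le_sum (f := fun i => (x i)^2) (fun _ _ => sq_nonneg _) hi)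

lemma rT_le {d : ℕ} {T : Finset (Fin d)} {x : E d} {M : ℝ} (hM : 0 ≤ M) (h : ∀ i ∈ T, |x i| ≤ M) :
    rT T x ≤ d * M := by
  have hd : (0:ℝ) ≤ d := Nat.cast_nonneg d
  apply Real.sqrt_le_iff.2 ⟨by positivity, ?_⟩
  calc ∑ i ∈ T, (x i)^2 ≤ ∑ i ∈ T, M^2 := by
        apply Finset.sum_le_sum; intro i hi
        exact sq_le_sq' (abs_le.1 (h i hi)).1 (abs_le.1 (h i hi)).2
    _ = T.card * M^2 := by simp
    _ ≤ d * M^2 := by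
        gcongr; simpa using T.card_le_univ
    _ ≤ (d * M)^2 := by
        rw [mul_pow]; gcongr
        norm_cast; exact Nat.le_self_pow (by norm_num) d

lemma rT_le_cube {d : ℕ} {T : Finset (Fin d)} {x : E d} (hx : x ∈ cube d) : rT T x ≤ d := by
  have := rT_le (T := T) (x := x) (M := 1) (by norm_num) (fun i _ => abs_le.2 ⟨(hx i).1.le, (hx i).2.le⟩)
  simpa using this

lemma rT_insert {n : ℕ} {T : Finset (Fin (n+1))} {σ : Fin (n+1)} (hσ : σ ∉ T) (t : ℝ) (y : Fin n → ℝ) :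
    rT T (ins σ t y) = rT T (ins σ 0 y) := by
  unfold rT
  congr 1
  apply Finset.sum_congr rfl
  intro i hi
  obtain ⟨k, rfl⟩ := Fin.exists_succAbove_eq (show i ≠ σ from fun h => hσ (h ▸ hi))
  simp

lemma ae_coord_ne {d : ℕ} (i : Fin d) : ∀ᵐ x : E d, x i ≠ 0 := by
  have h := Measure.ae_eval_ne (μ := fun _ : Fin d => (volume : Measure ℝ)) i 0
  exact (EuclideanSpace.volume_preserving_symm_measurableEquiv_toLp (Fin d)).quasiMeasurePreserving.ae h

lemma ae_rT_pos {d : ℕ} {T : Finset (Fin d)} (hT : T.Nonempty) : ∀ᵐ x : E d, 0 < rT T x := by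
  obtain ⟨i, hi⟩ := hT
  filter_upwards [ae_coord_ne i] with x hx
  exact lt_of_lt_of_le (abs_pos.2 hx) (abs_le_rT hi x)

lemma cube_eq (d : ℕ) : cube d = (MeasurableEquiv.toLp 2 (Fin d → ℝ)).symm ⁻¹' (Set.univ.pi fun _ => Ioo (-1:ℝ) 1) := by
  ext x; simp [cube]

lemma cube_meas (d : ℕ) : MeasurableSet (cube d) := by
  rw [cube_eq]
  exact (MeasurableEquiv.measurable _) (MeasurableSet.univ_pi fun _ => measurableSet_Ioo)

lemma cube_open (d : ℕ) : IsOpen (cube d) := by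
  have : cube d = ⋂ i, {x : E d | x i ∈ Ioo (-1:ℝ) 1} := by ext; simp [cube]
  rw [this]
  exact isOpen_iInter_of_finite fun i => isOpen_Ioo.preimage (by fun_prop)

lemma cube_vol (d : ℕ) : volume (cube d) ≠ ∞ := by
  rw [cube_eq, (EuclideanSpace.volume_preserving_symm_measurableEquiv_toLp (Fin d)).measure_preimage_equiv,
    volume_pi_pi]
  simp

lemma int_r {d : ℕ} {T : Finset (Fin d)} (hT : T.Nonempty) {e : ℝ} (he : 0 < e + T.card) :
    IntegrableOn (fun x => rT T x ^ e) (cube d) volume := by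
  have hk : (0:ℝ) < T.card := by exact_mod_cast hT.card_pos
  have hmeas : Measurable (fun x => rT T x ^ e) := (rT_cont T).measurable.pow_const e
  by_cases h0 : 0 ≤ e
  · refine Measure.integrableOn_of_bounded (M := (d:ℝ) ^ e) (cube_vol d) hmeas.aestronglyMeasurable ?_
    filter_upwards [ae_restrict_mem (cube_meas d)] with x hx
    rw [Real.norm_of_nonneg (Real.rpow_nonneg (rT_nonneg T x) _)]
    exact Real.rpow_le_rpow (rT_nonneg T x) (rT_le_cube hx) h0
  push Not at h0
  set g : Fin d → ℝ → ℝ := fun i t => if i ∈ T then |t| ^ (e / T.card) else 1 with hg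
  have hgi : ∀ i, Integrable (g i) (volume.restrict (Ioo (-1:ℝ) 1)) := by
    intro i
    by_cases hi : i ∈ T
    · simp only [hg, if_pos hi]
      have hexp : -1 < e / T.card := by rw [lt_div_iff₀ hk]; linarith
      have h1 : IntegrableOn (fun t : ℝ => |t| ^ (e / T.card)) (Ioo 0 1) := by
        refine (integrableOn_congr_fun ?_ measurableSet_Ioo).2
          ((intervalIntegral.integrableOn_Ioo_rpow_iff one_pos).2 hexp)
        intro t ht; simp only [abs_of_pos ht.1]
      have h2 : IntegrableOn (fun t : ℝ => |t| ^ (e / T.card)) (Ioo (-1) 0) := by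
        have := h1.comp_neg
        simpa using this
      have h3 : IntegrableOn (fun t : ℝ => |t| ^ (e / T.card)) {0} :=
        integrableOn_singleton (hx := by simp)
      refine ((h2.union h3).union h1).mono_set ?_
      intro t ht
      rcases lt_trichotomy t 0 with h | h | h
      · exact Or.inl (Or.inl ⟨ht.1, h⟩)
      · exact Or.inl (Or.inr h)
      · exact Or.inr ⟨h, ht.2⟩
    · simp only [hg, if_neg hi]
      exact integrable_const _
  have hG : IntegrableOn (fun x : E d => ∏ i, g i (x i)) (cube d) volume := by
    have h1 := Integrable.fintype_prod (μ := fun _ : Fin d => volume.restrict (Ioo (-1:ℝ) 1)) hgi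
    rw [← Measure.restrict_pi_pi] at h1
    rw [cube_eq]
    exact ((EuclideanSpace.volume_preserving_symm_measurableEquiv_toLp (Fin d)).integrableOn_comp_preimage
      (MeasurableEquiv.measurableEmbedding _) (f := fun x => ∏ i, g i (x i))).2 h1
  refine Integrable.mono' hG hmeas.aestronglyMeasurable ?_
  refine ae_restrict_of_ae ?_
  filter_upwards [ae_all_iff.2 (fun i => ae_coord_ne (d := d) i)] with x hx
  rw [Real.norm_of_nonneg (Real.rpow_nonneg (rT_nonneg T x) _)]
  have hr : 0 < rT T x := by
    obtain ⟨i, hi⟩ := hT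
    exact lt_of_lt_of_le (abs_pos.2 (hx i)) (abs_le_rT hi x)
  simp only [hg]
  rw [Finset.prod_ite_mem, Finset.univ_inter]
  calc rT T x ^ e = ∏ i ∈ T, rT T x ^ (e / T.card) := by
        rw [Finset.prod_const, ← Real.rpow_natCast, ← Real.rpow_mul hr.le, div_mul_cancel₀ _ hk.ne']
    _ ≤ _ := by
        apply Finset.prod_le_prod
        · intro i hi; positivity
        · intro i hi
          exact Real.rpow_le_rpow_of_nonpos (abs_pos.2 (hx i)) (abs_le_rT hi x)
            (div_nonpos_of_nonpos_of_nonneg h0.le hk.le)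

/-- Region near the singular set. -/
def regA {d : ℕ} (F : ℝ → ℝ) (σ : Fin d) (T : Finset (Fin d)) (m : ℝ) : Set (E d) :=
  {x | F (x σ - m * rT T x) < F (x σ + m * rT T x)}

lemma regA_open {d : ℕ} {F : ℝ → ℝ} (hF : Continuous F) (σ : Fin d) (T : Finset (Fin d)) (m : ℝ) :
    IsOpen (regA F σ T m) := by
  have := rT_cont T
  exact isOpen_lt (by fun_prop) (by fun_prop)

lemma int_A {n : ℕ} {D C c : ℝ} {F : ℝ → ℝ} (hF : CF D C c F) {T : Finset (Fin (n+1))}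
    (hT : T.Nonempty) {σ : Fin (n+1)} (hσ : σ ∉ T) {a : ℝ} (ha : 0 < a + 1 - D + T.card) :
    IntegrableOn ((regA F σ T 3).indicator (fun x => rT T x ^ a)) (cube (n+1)) volume := by
  obtain ⟨K, hK, hKb⟩ := vol_A hF
  have h1 := int_r hT (e := a + 1 - D) ha
  have hmeas : Measurable (fun x : E (n+1) => rT T x ^ a) := (rT_cont T).measurable.pow_const a
  have hmeas' : Measurable (fun x : E (n+1) => rT T x ^ (a + 1 - D)) :=
    (rT_cont T).measurable.pow_const _
  have hAm := (regA_open hF.cont σ T 3).measurableSet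
  refine ⟨(hmeas.indicator hAm).aestronglyMeasurable, ?_⟩
  have h2 := h1.2
  rw [hasFiniteIntegral_iff_enorm] at h2 ⊢
  refine lt_of_le_of_lt ?_ (ENNReal.mul_lt_top (ENNReal.ofReal_lt_top (r := K)) h2)
  have conv : ∀ g : E (n+1) → ℝ, Measurable g → ∫⁻ x in cube (n+1), ‖g x‖ₑ =
      ∫⁻ y, ∫⁻ t, (cube (n+1)).indicator (fun x => ‖g x‖ₑ) (ins σ t y) := by
    intro g hg
    rw [← lintegral_indicator (cube_meas _), ← (insE_mp σ).lintegral_comp_emb (insE σ).measurableEmbedding]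
    have hm : Measurable ((cube (n+1)).indicator (fun x => ‖g x‖ₑ)) :=
      hg.enorm.indicator (cube_meas _)
    exact lintegral_prod_symm _ (hm.comp (insE σ).measurable).aemeasurable
  rw [conv _ (hmeas.indicator hAm), conv _ hmeas', ← lintegral_const_mul' _ _ ENNReal.ofReal_ne_top]
  refine lintegral_mono fun y => ?_
  have hcube : ∀ t, ins σ t y ∈ cube (n+1) ↔ t ∈ Ioo (-1:ℝ) 1 ∧ ∀ j, y j ∈ Ioo (-1:ℝ) 1 := by
    intro t
    simp only [cube, mem_ofPred_eq]
    rw [Fin.forall_iff_succAbove σ]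
    simp
  by_cases hy : ∀ j, y j ∈ Ioo (-1:ℝ) 1
  swap
  · have : ∀ t, ins σ t y ∉ cube (n+1) := fun t h => hy ((hcube t).1 h).2
    simp [this]
  set r := rT T (ins σ 0 y) with hr
  have hrT : ∀ t, rT T (ins σ t y) = r := fun t => rT_insert hσ t y
  rcases (rT_nonneg T (ins σ 0 y)).eq_or_lt with h0 | h0
  · have : ∀ t, ins σ t y ∉ regA F σ T 3 := by
      intro t ht
      simp only [regA, mem_ofPred_eq, hrT, ← hr] at ht
      rw [hr, ← h0] at ht; simp at ht
    have h5 : ∀ t, (cube (n+1)).indicator (fun x => ‖(regA F σ T 3).indicator (fun x => rT T x ^ a) x‖ₑ)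
        (ins σ t y) = 0 := by
      intro t
      have h6 : ‖(regA F σ T 3).indicator (fun x => rT T x ^ a) (ins σ t y)‖ₑ = 0 := by
        rw [indicator_of_notMem (this t)]; simp
      by_cases hq : ins σ t y ∈ cube (n+1)
      · rw [indicator_of_mem hq]; exact h6
      · rw [indicator_of_notMem hq]
    simp only [h5, lintegral_zero, zero_le]
  · have e1 : ∀ t, (cube (n+1)).indicator (fun x => ‖(regA F σ T 3).indicator (fun x => rT T x ^ a) x‖ₑ)
        (ins σ t y) = ({s | F (s - 3 * r) < F (s + 3 * r)} ∩ Ioo (-1) 1).indicator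
          (fun _ => ENNReal.ofReal (r ^ a)) t := by
      intro t
      have hin : ins σ t y ∈ regA F σ T 3 ↔ t ∈ {s | F (s - 3 * r) < F (s + 3 * r)} := by
        simp only [regA, mem_ofPred_eq, hrT, ins_same]
      by_cases hc : t ∈ Ioo (-1:ℝ) 1
      · rw [indicator_of_mem ((hcube t).2 ⟨hc, hy⟩)]
        by_cases hA : t ∈ {s | F (s - 3 * r) < F (s + 3 * r)}
        · rw [indicator_of_mem (hin.2 hA), indicator_of_mem (show t ∈ {s | F (s - 3 * r) < F (s + 3 * r)} ∩ Ioo (-1) 1 from ⟨hA, hc⟩), hrT,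
            Real.enorm_of_nonneg (by positivity)]
        · rw [indicator_of_notMem (fun h => hA (hin.1 h)), indicator_of_notMem (fun h => hA h.1)]
          simp
      · rw [indicator_of_notMem (fun h => hc ((hcube t).1 h).1), indicator_of_notMem (fun h => hc h.2)]
    have e2 : ∀ t, (cube (n+1)).indicator (fun x => ‖rT T x ^ (a + 1 - D)‖ₑ)
        (ins σ t y) = (Ioo (-1:ℝ) 1).indicator (fun _ => ENNReal.ofReal (r ^ (a + 1 - D))) t := by
      intro t
      by_cases hc : t ∈ Ioo (-1:ℝ) 1
      · rw [indicator_of_mem ((hcube t).2 ⟨hc, hy⟩), indicator_of_mem hc, hrT,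
            Real.enorm_of_nonneg (by positivity)]
      · rw [indicator_of_notMem (fun h => hc ((hcube t).1 h).1), indicator_of_notMem hc]
    simp only [e1, e2]
    have hc := hF.cont
    rw [lintegral_indicator_const, lintegral_indicator_const measurableSet_Ioo, Real.volume_Ioo]
    · refine (mul_le_mul_right (hKb r h0) _).trans ?_
      rw [← ENNReal.ofReal_mul (by positivity), ← ENNReal.ofReal_mul (by positivity),
        ← ENNReal.ofReal_mul (by positivity)]
      apply ENNReal.ofReal_le_ofReal
      rw [show a + 1 - D = a + (1 - D) by ring, Real.rpow_add h0]
      have : 0 < r ^ a * r ^ (1 - D) := by positivity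
      nlinarith
    · exact ((isOpen_lt (by fun_prop) (by fun_prop)).measurableSet).inter measurableSet_Ioo

/-- Bad set. -/
def badZ {d : ℕ} (F : ℝ → ℝ) (σ : Fin d) (T : Finset (Fin d)) : Set (E d) :=
  {x | rT T x = 0 ∧ ∀ δ > 0, F (x σ - δ) < F (x σ + δ)}

lemma S_null {D C c : ℝ} {F : ℝ → ℝ} (hF : CF D C c F) :
    volume {s | ∀ δ > 0, F (s - δ) < F (s + δ)} = 0 := by
  obtain ⟨K, hK, hKb⟩ := vol_A hF
  have hD1 := hF.D1
  have ht : Tendsto (fun r : ℝ => ENNReal.ofReal (K * r ^ (1 - D))) (𝓝[>] 0) (𝓝 0) := by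
    have h1 : ContinuousAt (fun t : ℝ => K * t ^ (1 - D)) 0 :=
      (Real.continuousAt_rpow_const _ _ (Or.inr (by linarith))).const_mul K
    have h2 := h1.tendsto
    rw [Real.zero_rpow (by linarith), mul_zero] at h2
    have h3 := ENNReal.tendsto_ofReal h2
    rw [ENNReal.ofReal_zero] at h3
    exact h3.mono_left nhdsWithin_le_nhds
  refine le_antisymm (ge_of_tendsto ht ?_) (by simp)
  filter_upwards [self_mem_nhdsWithin] with r hr
  have hr' : 0 < r := hr
  refine le_trans (measure_mono ?_) (hKb r hr)
  intro s hs
  refine ⟨hs _ (by positivity), ?_, ?_⟩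
  · by_contra hc
    have := hs (-s) (by linarith)
    rw [hF.zero (s + -s) (by linarith), hF.zero (s - -s) (by linarith)] at this
    exact lt_irrefl _ this
  · by_contra hc
    have := hs (s - 1/4) (by linarith)
    rw [hF.one (s - (s - 1/4)) (by linarith), hF.one (s + (s - 1/4)) (by linarith)] at this
    exact lt_irrefl _ this

lemma badZ_slice {n : ℕ} {D C c : ℝ} {F : ℝ → ℝ} (hF : CF D C c F) {T : Finset (Fin (n+1))}
    (hT : T.Nonempty) {σ : Fin (n+1)} (hσ : σ ∉ T) (i : Fin (n+1)) :
    ∀ᵐ y, ∀ t, ins i t y ∉ badZ F σ T := by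
  rcases eq_or_ne i σ with rfl | hi
  · obtain ⟨j, hj⟩ := hT
    obtain ⟨k, rfl⟩ := Fin.exists_succAbove_eq (show j ≠ i from fun h => hσ (h ▸ hj))
    filter_upwards [Measure.ae_eval_ne (μ := fun _ : Fin n => (volume : Measure ℝ)) k 0] with y hy t hz
    have := abs_le_rT hj (ins i t y)
    rw [hz.1, ins_succAbove] at this
    exact hy (abs_nonpos_iff.1 this)
  · obtain ⟨k, hk⟩ := Fin.exists_succAbove_eq (show σ ≠ i from hi.symm)
    have h1 : ∀ᵐ s : ℝ, s ∉ {s | ∀ δ > 0, F (s - δ) < F (s + δ)} := by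
      rw [ae_iff]; simpa using S_null hF
    have h2 := (Measure.quasiMeasurePreserving_eval (μ := fun _ : Fin n => (volume : Measure ℝ)) k).ae h1
    filter_upwards [h2] with y hy t hz
    apply hy
    have := hz.2
    rw [← hk, ins_succAbove] at this
    exact this



lemma grad_apply {d : ℕ} (f : E d → ℝ) (x : E d) (i : Fin d) : gradient f x i = pd f i x := by
  have h := InnerProductSpace.toDual_symm_apply (𝕜 := ℝ) (x := EuclideanSpace.single i (1:ℝ)) (y := fderiv ℝ f x)
  rw [EuclideanSpace.inner_single_right] at h
  simpa [gradient, pd] using h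

lemma inner_grad {d : ℕ} (b : E d) (f : E d → ℝ) (x : E d) :
    ⟪b, gradient f x⟫ = ∑ i, b i * pd f i x := by
  rw [PiLp.inner_apply]
  refine Finset.sum_congr rfl fun i _ => ?_
  rw [grad_apply]; simp [mul_comm]

lemma norm_le_sum {d : ℕ} (v : E d) : ‖v‖ ≤ ∑ i, |v i| := by
  rw [EuclideanSpace.norm_eq]
  apply Real.sqrt_le_iff.2 ⟨Finset.sum_nonneg fun _ _ => abs_nonneg _, ?_⟩
  simp only [Real.norm_eq_abs]
  exact Finset.sum_sq_le_sq_sum_of_nonneg fun _ _ => abs_nonneg _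

lemma norm_le_of {d : ℕ} {v : E d} {M : ℝ} (h : ∀ i, |v i| ≤ M) : ‖v‖ ≤ d * M := by
  refine (norm_le_sum v).trans ((Finset.sum_le_sum fun i _ => h i).trans ?_)
  simp

/-- Compact set inside the cube. -/
def KK (d : ℕ) : Set (E d) := {x | ∀ i, |x i| ≤ 99/100}

lemma KK_closed (d : ℕ) : IsClosed (KK d) := by
  have : KK d = ⋂ i, {x : E d | |x i| ≤ 99/100} := by ext; simp [KK]
  rw [this]
  exact isClosed_iInter fun i => isClosed_le (by fun_prop) (by fun_prop)

lemma box_compact (d : ℕ) {M : ℝ} (hM : 0 ≤ M) {S : Set (E d)} (hS : IsClosed S) (h : ∀ x ∈ S, ∀ i, |x i| ≤ M) :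
    IsCompact S := by
  refine (isCompact_closedBall (0 : E d) (d * M)).of_isClosed_subset hS ?_
  intro x hx
  rw [mem_closedBall_zero_iff]
  exact norm_le_of (h x hx)

lemma KK_compact (d : ℕ) : IsCompact (KK d) := box_compact d (by norm_num) (KK_closed d) fun _ h => h

lemma KK_sub (d : ℕ) : KK d ⊆ cube d := fun x hx i =>
  ⟨by have := (abs_le.1 (hx i)).1; linarith, by have := (abs_le.1 (hx i)).2; linarith⟩

lemma pd_congr {d : ℕ} {f g : E d → ℝ} {x : E d} (h : f =ᶠ[𝓝 x] g) (i : Fin d) : pd f i x = pd g i x := by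
  unfold pd; rw [h.fderiv_eq]

lemma pd_const {d : ℕ} {f : E d → ℝ} {x : E d} {a : ℝ} (h : f =ᶠ[𝓝 x] fun _ => a) (i : Fin d) : pd f i x = 0 := by
  rw [pd_congr h]; simp [pd]

lemma pd_mul {d : ℕ} {f g : E d → ℝ} {x : E d} (hf : DifferentiableAt ℝ f x) (hg : DifferentiableAt ℝ g x)
    (i : Fin d) : pd (fun y => f y * g y) i x = f x * pd g i x + g x * pd f i x := by
  unfold pd
  rw [fderiv_fun_mul hf hg]; simp

lemma pd_meas {d : ℕ} (f : E d → ℝ) (i : Fin d) : Measurable (pd f i) := by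
  exact measurable_fderiv_apply_const ℝ f _

/-- Admissible functions. -/
structure Nice {n : ℕ} (Z : Set (E (n+1))) (f : E (n+1) → ℝ) : Prop where
  diff : ∀ x ∉ Z, DifferentiableAt ℝ f x
  int : Integrable f
  intd : ∀ i, Integrable (pd f i)
  supp : ∀ x ∉ KK (n+1), f x = 0

lemma supp_pd {d : ℕ} {f : E d → ℝ} (h : ∀ x ∉ KK d, f x = 0) (i : Fin d) (x : E d) (hx : x ∉ KK d) :
    pd f i x = 0 := by
  refine pd_const (a := 0) ?_ i
  filter_upwards [(KK_closed d).isOpen_compl.mem_nhds hx] with y hy using h y hy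

open Manifold in
lemma exists_cut {d : ℕ} (v : E d → ℝ) (hv : ContDiffOn ℝ (⊤ : ℕ∞) v (cube d)) :
    ∃ V : E d → ℝ, ContDiff ℝ (⊤ : ℕ∞) V ∧ HasCompactSupport V ∧ ∀ x ∈ KK d, V =ᶠ[𝓝 x] v := by
  obtain ⟨f, h0, h1, -⟩ := exists_contMDiffMap_zero_one_nhds_of_isClosed (n := (⊤ : ℕ∞)) (𝓘(ℝ, E d))
    (cube_open d).isClosed_compl (KK_closed d)
    (Set.disjoint_left.2 fun x hx hk => hx (KK_sub d hk))
  have hf : ContDiff ℝ (⊤ : ℕ∞) f := f.contMDiff.contDiff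
  rw [Filter.Eventually, mem_nhdsSet_iff_forall] at h0 h1
  refine ⟨fun x => f x * v x, ?_, ?_, ?_⟩
  · rw [contDiff_iff_contDiffAt]
    intro x
    by_cases hx : x ∈ cube d
    · exact hf.contDiffAt.mul (hv.contDiffAt ((cube_open d).mem_nhds hx))
    · refine (contDiffAt_const (c := (0:ℝ))).congr_of_eventuallyEq ?_
      filter_upwards [h0 x hx] with y hy
      have : f y = 0 := hy
      simp [this]
  · refine HasCompactSupport.of_support_subset_isCompact
      (K := {x : E d | ∀ i, |x i| ≤ 1}) (box_compact d zero_le_one ?_ fun _ h => h) ?_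
    · have : {x : E d | ∀ i, |x i| ≤ 1} = ⋂ i, {x : E d | |x i| ≤ 1} := by ext; simp
      rw [this]
      exact isClosed_iInter fun i => isClosed_le (by fun_prop) (by fun_prop)
    · intro x hx i
      by_cases hc : x ∈ cube d
      · exact abs_le.2 ⟨(hc i).1.le, (hc i).2.le⟩
      · exfalso; apply hx
        have : x ∈ {x | f x = 0} := mem_of_mem_nhds (h0 x hc)
        have : f x = 0 := this
        simp [this]
  · intro x hx
    filter_upwards [h1 x hx] with y hy
    have : f y = 1 := hy
    simp [this]

lemma pd_contDiff {d : ℕ} {V : E d → ℝ} (hV : ContDiff ℝ (⊤ : ℕ∞) V) (i : Fin d) :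
    ContDiff ℝ 1 (pd V i) := by
  have h : ContDiff ℝ 2 V := by
    have := contDiff_infty.1 hV 2
    exact_mod_cast this
  exact (h.fderiv_right (m := 1) (by norm_num)).clm_apply contDiff_const

lemma pd_symm {d : ℕ} {V : E d → ℝ} (hV : ContDiff ℝ (⊤ : ℕ∞) V) (i j : Fin d) (x : E d) :
    pd (pd V i) j x = pd (pd V j) i x := by
  have h : ContDiff ℝ 2 V := by
    have := contDiff_infty.1 hV 2
    exact_mod_cast this
  have hs : IsSymmSndFDerivAt ℝ V x := h.contDiffAt.isSymmSndFDerivAt (by simp)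
  have hd : DifferentiableAt ℝ (fderiv ℝ V) x :=
    ((h.fderiv_right (m := 1) (by norm_num)).differentiable (by norm_num)).differentiableAt
  have key : ∀ a b : Fin d, pd (pd V a) b x =
      fderiv ℝ (fderiv ℝ V) x (EuclideanSpace.single b 1) (EuclideanSpace.single a 1) := by
    intro a b
    have : pd V a = fun y => fderiv ℝ V y (EuclideanSpace.single a 1) := rfl
    rw [this]
    unfold pd
    rw [fderiv_clm_apply hd (differentiableAt_const _)]
    simp
  rw [key, key]
  exact hs _ _

lemma ortho {n : ℕ} {Z : Set (E (n+1))} (hZ : ∀ i, ∀ᵐ y, ∀ t, ins i t y ∉ Z) {f : E (n+1) → ℝ}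
    (hf : Nice Z f) (i j : Fin (n+1)) {v : E (n+1) → ℝ} (hv : ContDiffOn ℝ (⊤ : ℕ∞) v (cube (n+1))) :
    IntegrableOn (fun x => pd f i x * pd v j x - pd f j x * pd v i x) (cube (n+1)) ∧
    ∫ x in cube (n+1), (pd f i x * pd v j x - pd f j x * pd v i x) = 0 := by
  obtain ⟨V, hV, hVs, hVv⟩ := exists_cut v hv
  have e : (fun x => pd f i x * pd v j x - pd f j x * pd v i x) =
      fun x => pd f i x * pd V j x - pd f j x * pd V i x := by
    funext x
    by_cases hx : x ∈ KK (n+1)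
    · rw [pd_congr (hVv x hx) i, pd_congr (hVv x hx) j]
    · rw [supp_pd hf.supp i x hx, supp_pd hf.supp j x hx]; simp
  rw [e]
  have hV1 : ContDiff ℝ 1 V := hV.of_le (by exact_mod_cast le_top)
  have k1 := int_mul_bdd (hf.intd i) (pd_cont hV1 j) (pd_supp hVs j)
  have k2 := int_mul_bdd (hf.intd j) (pd_cont hV1 i) (pd_supp hVs i)
  refine ⟨(k1.sub k2).integrableOn, ?_⟩
  rw [setIntegral_eq_integral_of_forall_compl_eq_zero, integral_sub k1 k2]
  · have w1 := weak_deriv hZ hf.diff hf.int i (hf.intd i) (pd_contDiff hV j) (pd_supp hVs j)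
    have w2 := weak_deriv hZ hf.diff hf.int j (hf.intd j) (pd_contDiff hV i) (pd_supp hVs i)
    have : (fun x => f x * pd (pd V j) i x) = fun x => f x * pd (pd V i) j x := by
      funext x; rw [pd_symm hV]
    rw [this] at w1
    linarith
  · intro x hx
    have hx' : x ∉ KK (n+1) := fun h => hx (KK_sub _ h)
    rw [supp_pd hf.supp i x hx', supp_pd hf.supp j x hx']; simp

/-- Elementary divergence free field. -/
def CC {d : ℕ} (f : E d → ℝ) (i j : Fin d) (x : E d) : E d :=
  EuclideanSpace.single j (pd f i x) - EuclideanSpace.single i (pd f j x)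

lemma CC_apply {d : ℕ} (f : E d → ℝ) (i j : Fin d) (x : E d) (m : Fin d) :
    CC f i j x m = (if m = j then pd f i x else 0) - (if m = i then pd f j x else 0) := by
  simp [CC, Pi.single_apply]

lemma CC_inner {d : ℕ} (f g : E d → ℝ) (i j : Fin d) (x : E d) :
    ⟪CC f i j x, gradient g x⟫ = pd f i x * pd g j x - pd f j x * pd g i x := by
  rw [inner_grad]
  simp [CC_apply, sub_mul, Finset.sum_sub_distrib]

lemma integrable_E {d : ℕ} {g : E d → E d} {μ : Measure (E d)} (h : ∀ i, Integrable (fun x => g x i) μ) :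
    Integrable g μ := by
  exact Integrable.of_eval_piLp h

lemma Nice.weak {n : ℕ} {Z : Set (E (n+1))} (hZ : ∀ i, ∀ᵐ y, ∀ t, ins i t y ∉ Z) {f : E (n+1) → ℝ}
    (hf : Nice Z f) (e : ℝ) : MemW011 (n+1) (fun x => e * f x) (fun x => e • gradient f x) := by
  refine ⟨(hf.int.const_mul e).integrableOn, ?_, ?_⟩
  · refine (integrable_E fun i => ?_).integrableOn
    simp only [PiLp.smul_apply, grad_apply, smul_eq_mul]
    exact (hf.intd i).const_mul e
  · intro ξ hξ hs i
    have hξ1 : ContDiff ℝ 1 ξ := hξ.of_le (by exact_mod_cast le_top)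
    have w := weak_deriv hZ hf.diff hf.int i (hf.intd i) hξ1 hs
    rw [setIntegral_eq_integral_of_forall_compl_eq_zero, setIntegral_eq_integral_of_forall_compl_eq_zero]
    · simp only [PiLp.smul_apply, grad_apply, smul_eq_mul, mul_assoc]
      rw [integral_const_mul, integral_const_mul]
      unfold pd at w ⊢
      rw [w]; ring
    · intro x hx
      have hx' : x ∉ KK (n+1) := fun h => hx (KK_sub _ h)
      simp [grad_apply, supp_pd hf.supp i x hx']
    · intro x hx
      have hx' : x ∉ KK (n+1) := fun h => hx (KK_sub _ h)
      simp [hf.supp x hx']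

lemma small_eps {p A J : ℝ} (hp : 1 < p) (hA : 0 ≤ A) (hJ : J < 0) : ∃ e : ℝ, 0 < e ∧ e ^ p * A + e * J < 0 := by
  have h1 : ContinuousAt (fun e : ℝ => e ^ (p - 1) * A + J) 0 :=
    ((Real.continuousAt_rpow_const _ _ (Or.inr (by linarith))).mul_const A).add_const J
  have h2 : ∀ᶠ e : ℝ in 𝓝 0, e ^ (p-1) * A + J < 0 := by
    apply h1.eventually_lt continuousAt_const
    rw [Real.zero_rpow (by linarith)]; simpa using hJ
  have h3 : ∀ᶠ e : ℝ in 𝓝[>] 0, e ^ (p-1) * A + J < 0 := h2.filter_mono nhdsWithin_le_nhds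
  obtain ⟨e, he, he0⟩ := (h3.and self_mem_nhdsWithin).exists
  have he0 : 0 < e := he0
  refine ⟨e, he0, ?_⟩
  have : e ^ p = e * e ^ (p-1) := by
    rw [mul_comm, Real.rpow_sub_one he0.ne', div_mul_cancel₀ _ he0.ne']
  rw [this]
  nlinarith

lemma finish {n : ℕ} {ι : Type} {Z : Set (E (n+1))} (hZ : ∀ i, ∀ᵐ y, ∀ t, ins i t y ∉ Z)
    {p : ℝ} (hp : 1 < p) (S : Finset ι) (f : ι → E (n+1) → ℝ) (i : ι → Fin (n+1)) (j : Fin (n+1))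
    (hf : ∀ a ∈ S, Nice Z (f a)) {w : E (n+1) → ℝ} (hw : Nice Z w) {ω : E (n+1) → ℝ} (hω : ∀ x, 0 ≤ ω x)
    (b0 : E (n+1) → E (n+1)) (hb : ∀ x, b0 x = ∑ a ∈ S, CC (f a) (i a) j x)
    (h1 : IntegrableOn (fun x => (‖b0 x‖ / ω x) ^ (p / (p - 1))) (cube (n+1)) volume)
    (h2 : IntegrableOn (fun x => (ω x * ‖gradient w x‖) ^ p) (cube (n+1)) volume)
    (h3 : ∫ x in cube (n+1), ⟪b0 x, gradient w x⟫ < 0) :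
    IntegrableOn b0 (cube (n+1)) volume ∧
    (∃ K : Set (E (n+1)), IsCompact K ∧ K ⊆ cube (n+1) ∧ ∀ x ∉ K, b0 x = 0) ∧
    IntegrableOn (fun x => (‖b0 x‖ / ω x) ^ (p / (p - 1))) (cube (n+1)) volume ∧
    (∀ v : E (n+1) → ℝ, ContDiffOn ℝ (⊤ : ℕ∞) v (cube (n+1)) →
      ∫ x in cube (n+1), ⟪b0 x, gradient v x⟫ = 0) ∧
    (∀ v : E (n+1) → ℝ, ContDiff ℝ (⊤ : ℕ∞) v → HasCompactSupport v → tsupport v ⊆ cube (n+1) →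
      0 ≤ (∫ x in cube (n+1), (ω x * ‖gradient v x‖) ^ p / p) +
            ∫ x in cube (n+1), ⟪b0 x, gradient v x⟫) ∧
    (∃ (w : E (n+1) → ℝ) (g : E (n+1) → E (n+1)), MemW011 (n+1) w g ∧
      IntegrableOn (fun x => (ω x * ‖g x‖) ^ p / p) (cube (n+1)) volume ∧
      (∫ x in cube (n+1), (ω x * ‖g x‖) ^ p / p) + (∫ x in cube (n+1), ⟪b0 x, g x⟫) < 0) := by
  have hi : ∀ v : E (n+1) → ℝ, ContDiffOn ℝ (⊤ : ℕ∞) v (cube (n+1)) →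
      ∫ x in cube (n+1), ⟪b0 x, gradient v x⟫ = 0 := by
    intro v hv
    simp only [hb, sum_inner, CC_inner]
    rw [integral_finsetSum _ fun a ha => (ortho hZ (hf a ha) _ _ hv).1]
    exact Finset.sum_eq_zero fun a ha => (ortho hZ (hf a ha) _ _ hv).2
  have hpos : ∀ g : E (n+1) → E (n+1), 0 ≤ ∫ x in cube (n+1), (ω x * ‖g x‖) ^ p / p := by
    intro g
    refine integral_nonneg fun x => ?_
    have := hω x
    positivity
  refine ⟨?_, ⟨KK (n+1), KK_compact _, KK_sub _, ?_⟩, h1, hi, ?_, ?_⟩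
  · have : b0 = fun x => ∑ a ∈ S, CC (f a) (i a) j x := funext hb
    rw [this]
    refine (integrable_finsetSum _ fun a ha => integrable_E fun m => ?_).integrableOn
    simp only [CC_apply]
    refine Integrable.sub ?_ ?_
    · split_ifs
      · exact (hf a ha).intd _
      · exact integrable_zero _ _ _
    · split_ifs
      · exact (hf a ha).intd _
      · exact integrable_zero _ _ _
  · intro x hx
    rw [hb]
    refine Finset.sum_eq_zero fun a ha => ?_
    ext m
    simp [CC_apply, supp_pd (hf a ha).supp _ x hx]
  · intro v hv _ _
    rw [hi v hv.contDiffOn, add_zero]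
    exact hpos _
  · set A := ∫ x in cube (n+1), (ω x * ‖gradient w x‖) ^ p / p with hA
    obtain ⟨e, he, hlt⟩ := small_eps hp (hpos (gradient w)) h3
    have key : (fun x => (ω x * ‖e • gradient w x‖) ^ p / p) =
        fun x => e ^ p * ((ω x * ‖gradient w x‖) ^ p / p) := by
      funext x
      rw [norm_smul, Real.norm_of_nonneg he.le, mul_left_comm, Real.mul_rpow he.le
        (mul_nonneg (hω x) (norm_nonneg _)), mul_div_assoc]
    refine ⟨_, _, hw.weak hZ e, ?_, ?_⟩
    · rw [key]
      exact (h2.div_const p).const_mul _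
    · rw [key, integral_const_mul]
      simp only [real_inner_smul_right]
      rw [integral_const_mul]
      exact hlt



/-- One dimensional cut-off. -/
def bump (ρ x : ℝ) : ℝ := Real.smoothTransition (2 - (x / ρ)^2)

lemma bump_contDiff (ρ : ℝ) : ContDiff ℝ 1 (bump ρ) := by
  unfold bump
  exact Real.smoothTransition.contDiff.comp (by fun_prop)

lemma bump_nonneg (ρ x : ℝ) : 0 ≤ bump ρ x := Real.smoothTransition.nonneg _

lemma bump_le_one (ρ x : ℝ) : bump ρ x ≤ 1 := Real.smoothTransition.le_one _

lemma bump_one {ρ x : ℝ} (hρ : 0 < ρ) (h : |x| ≤ ρ) : bump ρ x = 1 := by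
  apply Real.smoothTransition.one_of_one_le
  have : (x / ρ)^2 ≤ 1 := by
    rw [div_pow, div_le_one (by positivity)]
    exact sq_le_sq.2 (by rwa [abs_of_pos hρ])
  linarith

lemma bump_zero {ρ x : ℝ} (hρ : 0 < ρ) (h : 2 * ρ^2 ≤ x^2) : bump ρ x = 0 := by
  apply Real.smoothTransition.zero_of_nonpos
  have : 2 ≤ (x / ρ)^2 := by
    rw [div_pow, le_div_iff₀ (by positivity)]; exact h
  linarith

lemma bump_hasDeriv (ρ x : ℝ) : HasDerivAt (bump ρ) (deriv (bump ρ) x) x :=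
  ((bump_contDiff ρ).differentiable (by norm_num)).differentiableAt.hasDerivAt

lemma bump_deriv_eq (ρ x : ℝ) : deriv (bump ρ) x =
    deriv Real.smoothTransition (2 - (x/ρ)^2) * (- (2 * x / ρ^2)) := by
  have h1 : HasDerivAt (fun x : ℝ => 2 - (x/ρ)^2) (- (2 * x / ρ^2)) x := by
    have := (((hasDerivAt_id x).div_const ρ).pow 2).const_sub 2
    refine this.congr_deriv ?_
    simp only [id]; norm_num; ring
  exact ((hst_hasDeriv _).comp x h1).deriv

lemma bump_mul_deriv (ρ x : ℝ) : x * deriv (bump ρ) x ≤ 0 := by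
  rw [bump_deriv_eq]
  have h1 : 0 ≤ deriv Real.smoothTransition (2 - (x/ρ)^2) := Real.smoothTransition.monotone.deriv_nonneg
  have h2 : 0 ≤ x * (2 * x / ρ^2) := by
    have : x * (2 * x / ρ^2) = 2 * (x^2 / ρ^2) := by ring
    rw [this]; positivity
  nlinarith

lemma bump_deriv_zero {ρ x : ℝ} (hρ : 0 < ρ) (h : |x| < ρ) : deriv (bump ρ) x = 0 := by
  have : bump ρ =ᶠ[𝓝 x] fun _ => 1 := by
    filter_upwards [(isOpen_lt continuous_abs continuous_const).mem_nhds h] with y hy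
    exact bump_one hρ (le_of_lt hy)
  rw [this.deriv_eq]; simp

lemma bump_deriv_bd {ρ : ℝ} (hρ : 0 < ρ) : ∃ M, 0 < M ∧ ∀ x, |deriv (bump ρ) x| ≤ M := by
  have hs : HasCompactSupport (bump ρ) := by
    refine HasCompactSupport.of_support_subset_isCompact (isCompact_Icc (a := -(2*ρ)) (b := 2*ρ)) ?_
    intro x hx
    by_contra hc
    apply hx
    apply bump_zero hρ
    rw [mem_Icc, ← abs_le] at hc
    push Not at hc
    have : (2*ρ)^2 < x^2 := sq_lt_sq.2 (by rwa [abs_of_pos (by positivity)])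
    nlinarith
  obtain ⟨M, hM⟩ := ((bump_contDiff ρ).continuous_deriv le_rfl).bounded_above_of_compact_support hs.deriv
  refine ⟨max M 1, by positivity, fun x => (hM x).trans (le_max_left _ _)⟩

lemma bump_neg {ρ : ℝ} (hρ : 0 < ρ) : ∃ x, ρ < x ∧ x < 2 * ρ ∧ deriv (bump ρ) x < 0 := by
  obtain ⟨x, hx, he⟩ := exists_deriv_eq_slope (bump ρ) (show ρ < 2*ρ by linarith)
    (bump_contDiff ρ).continuous.continuousOn
    ((bump_contDiff ρ).differentiable (by norm_num)).differentiableOn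
  refine ⟨x, hx.1, hx.2, ?_⟩
  rw [he, bump_one (x := ρ) hρ (by rw [abs_of_pos hρ]), bump_zero (x := 2 * ρ) hρ (by nlinarith)]
  apply div_neg_of_neg_of_pos <;> linarith

/-- Product cut-off. -/
def cut {d : ℕ} (S : Finset (Fin d)) (ρ : ℝ) (x : E d) : ℝ := ∏ i ∈ S, bump ρ (x i)

section
variable {d : ℕ} (S : Finset (Fin d)) {ρ : ℝ}

lemma cut_contDiff (ρ : ℝ) : ContDiff ℝ 1 (cut S ρ) := by
  unfold cut
  refine contDiff_prod fun i _ => (bump_contDiff ρ).comp ?_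
  exact (EuclideanSpace.proj (𝕜 := ℝ) i).contDiff

lemma cut_diff (ρ : ℝ) (x : E d) : DifferentiableAt ℝ (cut S ρ) x :=
  ((cut_contDiff S ρ).differentiable (by norm_num)).differentiableAt

lemma cut_nonneg (ρ : ℝ) (x : E d) : 0 ≤ cut S ρ x := Finset.prod_nonneg fun _ _ => bump_nonneg _ _

lemma cut_le_one (ρ : ℝ) (x : E d) : cut S ρ x ≤ 1 :=
  Finset.prod_le_one (fun _ _ => bump_nonneg _ _) fun _ _ => bump_le_one _ _

lemma cut_one (hρ : 0 < ρ) {x : E d} (h : ∀ i ∈ S, |x i| < ρ) : cut S ρ =ᶠ[𝓝 x] fun _ => 1 := by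
  have : ∀ i ∈ S, ∀ᶠ y : E d in 𝓝 x, |y i| < ρ := fun i hi =>
    (isOpen_lt (by fun_prop) continuous_const).mem_nhds (h i hi)
  filter_upwards [(Filter.eventually_all_finset S).2 this] with y hy
  exact Finset.prod_eq_one fun i hi => bump_one hρ (hy i hi).le

lemma cut_zero (hρ : 0 < ρ) {x : E d} {i : Fin d} (hi : i ∈ S) (h : 2 * ρ^2 < (x i)^2) :
    cut S ρ =ᶠ[𝓝 x] fun _ => 0 := by
  have : ∀ᶠ y : E d in 𝓝 x, 2 * ρ^2 < (y i)^2 :=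
    (isOpen_lt continuous_const (by fun_prop)).mem_nhds h
  filter_upwards [this] with y hy
  exact Finset.prod_eq_zero hi (bump_zero hρ hy.le)

lemma pd_line {f : E d → ℝ} {x : E d} (hf : DifferentiableAt ℝ f x) (j : Fin d) :
    HasDerivAt (fun t : ℝ => f (x + t • EuclideanSpace.single j (1:ℝ))) (pd f j x) 0 := by
  have h1 : HasDerivAt (fun t : ℝ => x + t • EuclideanSpace.single j (1:ℝ)) (EuclideanSpace.single j (1:ℝ)) 0 := by
    simpa using ((hasDerivAt_id (0:ℝ)).smul_const (EuclideanSpace.single j (1:ℝ))).const_add x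
  have h2 : HasFDerivAt f (fderiv ℝ f x) (x + (0:ℝ) • EuclideanSpace.single j (1:ℝ)) := by
    simpa using hf.hasFDerivAt
  exact h2.comp_hasDerivAt (0:ℝ) h1

lemma cut_pd_mem {j : Fin d} (hj : j ∈ S) (ρ : ℝ) (x : E d) :
    pd (cut S ρ) j x = deriv (bump ρ) (x j) * ∏ i ∈ S.erase j, bump ρ (x i) := by
  have h := pd_line (cut_diff S ρ x) j
  refine h.unique ?_
  have e : (fun t : ℝ => cut S ρ (x + t • EuclideanSpace.single j (1:ℝ))) =
      fun t => bump ρ (x j + t) * ∏ i ∈ S.erase j, bump ρ (x i) := by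
    funext t
    unfold cut
    rw [← Finset.mul_prod_erase S _ hj]
    congr 1
    · simp
    · refine Finset.prod_congr rfl fun i hi => ?_
      simp [Finset.ne_of_mem_erase hi]
  rw [e]
  have h1 : HasDerivAt (fun t : ℝ => bump ρ (x j + t)) (deriv (bump ρ) (x j)) 0 := by
    have := bump_hasDeriv ρ (x j + 0)
    have := HasDerivAt.comp_const_add (x j) 0 this
    simpa using this
  exact h1.mul_const _

lemma cut_pd_notMem {j : Fin d} (hj : j ∉ S) (ρ : ℝ) (x : E d) : pd (cut S ρ) j x = 0 := by
  have h := pd_line (cut_diff S ρ x) j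
  refine h.unique ?_
  have e : (fun t : ℝ => cut S ρ (x + t • EuclideanSpace.single j (1:ℝ))) = fun t => cut S ρ x := by
    funext t
    refine Finset.prod_congr rfl fun i hi => ?_
    have : i ≠ j := fun h => hj (h ▸ hi)
    simp [this]
  rw [e]
  exact hasDerivAt_const _ _

lemma cut_mul_pd (ρ : ℝ) (x : E d) (j : Fin d) : x j * pd (cut S ρ) j x ≤ 0 := by
  by_cases hj : j ∈ S
  · rw [cut_pd_mem S hj, ← mul_assoc]
    exact mul_nonpos_of_nonpos_of_nonneg (bump_mul_deriv _ _) (Finset.prod_nonneg fun _ _ => bump_nonneg _ _)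
  · rw [cut_pd_notMem S hj]; simp

lemma cut_pd_near (hρ : 0 < ρ) {x : E d} {j : Fin d} (h : |x j| < ρ) : pd (cut S ρ) j x = 0 := by
  by_cases hj : j ∈ S
  · rw [cut_pd_mem S hj, bump_deriv_zero hρ h, zero_mul]
  · rw [cut_pd_notMem S hj]

lemma cut_pd_bd (hρ : 0 < ρ) : ∃ M, 0 < M ∧ ∀ x j, |pd (cut S ρ) j x| ≤ M := by
  obtain ⟨M, hM, hb⟩ := bump_deriv_bd hρ
  refine ⟨M, hM, fun x j => ?_⟩
  by_cases hj : j ∈ S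
  · rw [cut_pd_mem S hj, abs_mul]
    have h1 : |∏ i ∈ S.erase j, bump ρ (x i)| ≤ 1 := by
      rw [abs_of_nonneg (Finset.prod_nonneg fun _ _ => bump_nonneg _ _)]
      exact Finset.prod_le_one (fun _ _ => bump_nonneg _ _) fun _ _ => bump_le_one _ _
    calc _ ≤ M * 1 := mul_le_mul (hb _) h1 (abs_nonneg _) hM.le
      _ = M := mul_one M
  · rw [cut_pd_notMem S hj]; simpa using hM.le

end

lemma int_dom {n : ℕ} {D C c : ℝ} {F : ℝ → ℝ} (hF : CF D C c F) {T : Finset (Fin (n+1))}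
    (hT : T.Nonempty) {σ : Fin (n+1)} (hσ : σ ∉ T) {q a1 a2 M : ℝ} (hq : 0 < q) (hM : 0 ≤ M)
    {g : E (n+1) → ℝ} (hg : Measurable g) (hg0 : ∀ x, 0 ≤ g x)
    (h : ∀ x ∈ cube (n+1), 0 < rT T x → g x ≤ M * rT T x ^ a1 ∨ (x ∈ regA F σ T 3 ∧ g x ≤ M * rT T x ^ a2))
    (h1 : 0 < a1 * q + T.card) (h2 : 0 < a2 * q + 1 - D + T.card) :
    IntegrableOn (fun x => g x ^ q) (cube (n+1)) volume := by
  have k1 := (int_r hT h1).const_mul (M ^ q)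
  have k2 := (int_A hF hT hσ h2).const_mul (M ^ q)
  refine Integrable.mono' (k1.add k2) (hg.pow_const q).aestronglyMeasurable ?_
  filter_upwards [ae_restrict_mem (cube_meas _), ae_restrict_of_ae (ae_rT_pos hT)] with x hx hr
  have hMq : 0 ≤ M ^ q := Real.rpow_nonneg hM _
  rw [Real.norm_of_nonneg (Real.rpow_nonneg (hg0 x) _)]
  have cv : ∀ a, (M * rT T x ^ a) ^ q = M ^ q * rT T x ^ (a * q) := by
    intro a
    rw [Real.mul_rpow hM (Real.rpow_nonneg hr.le _), ← Real.rpow_mul hr.le]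
  have n1 : 0 ≤ M ^ q * rT T x ^ (a1 * q) := mul_nonneg hMq (Real.rpow_nonneg hr.le _)
  have n2 : 0 ≤ M ^ q * (regA F σ T 3).indicator (fun x => rT T x ^ (a2 * q)) x :=
    mul_nonneg hMq (Set.indicator_nonneg (fun y _ => Real.rpow_nonneg (rT_nonneg _ _) _) x)
  simp only [Pi.add_apply]
  rcases h x hx hr with h | ⟨hA, h⟩
  · have := Real.rpow_le_rpow (hg0 x) h hq.le
    rw [cv] at this
    linarith
  · have := Real.rpow_le_rpow (hg0 x) h hq.le
    rw [cv] at this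
    rw [indicator_of_mem hA] at n2 ⊢
    linarith

lemma int_dom1 {n : ℕ} {D C c : ℝ} {F : ℝ → ℝ} (hF : CF D C c F) {T : Finset (Fin (n+1))}
    (hT : T.Nonempty) {σ : Fin (n+1)} (hσ : σ ∉ T) {a2 M : ℝ} (hM : 0 ≤ M)
    {g : E (n+1) → ℝ} (hg : Measurable g) (hgK : ∀ x ∉ KK (n+1), g x = 0)
    (h : ∀ x ∈ cube (n+1), 0 < rT T x → |g x| ≤ M ∨ (x ∈ regA F σ T 3 ∧ |g x| ≤ M * rT T x ^ a2))
    (h2 : 0 < a2 + 1 - D + T.card) : Integrable g := by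
  have hk : (0:ℝ) < T.card := by exact_mod_cast hT.card_pos
  have := int_dom hF hT hσ (q := 1) (a1 := 0) (a2 := a2) one_pos hM (measurable_abs.comp hg)
    (fun x => abs_nonneg _) (by simpa using h) (by simpa using hk) (by simpa using h2)
  simp only [Real.rpow_one, Function.comp_def] at this
  have h3 : IntegrableOn g (cube (n+1)) := (integrable_norm_iff hg.aestronglyMeasurable).1 this
  refine (integrableOn_iff_integrable_of_support_subset ?_).1 h3
  intro x hx
  by_contra hc
  exact hx (hgK x fun h => hc (KK_sub _ h))



/-- derivative of `rT` -/
def drT {d : ℕ} (T : Finset (Fin d)) (x : E d) : E d →L[ℝ] ℝ :=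
  ∑ i ∈ T, (x i / rT T x) • (EuclideanSpace.proj i : E d →L[ℝ] ℝ)

lemma proj_deriv {d : ℕ} (i : Fin d) (x : E d) :
    HasFDerivAt (fun y : E d => y i) (EuclideanSpace.proj i : E d →L[ℝ] ℝ) x :=
  (EuclideanSpace.proj (𝕜 := ℝ) i).hasFDerivAt

lemma proj_single {d : ℕ} (i j : Fin d) :
    (EuclideanSpace.proj i : E d →L[ℝ] ℝ) (EuclideanSpace.single j 1) = if j = i then 1 else 0 := by
  by_cases h : i = j
  · subst h; simp
  · simp [h, Ne.symm h]

lemma rT_deriv {d : ℕ} {T : Finset (Fin d)} {x : E d} (h : 0 < rT T x) :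
    HasFDerivAt (rT T) (drT T x) x := by
  have h1 : HasFDerivAt (fun y : E d => ∑ i ∈ T, (y i)^2)
      (∑ i ∈ T, (2 * x i) • (EuclideanSpace.proj i : E d →L[ℝ] ℝ)) x := by
    refine HasFDerivAt.fun_sum fun i _ => ?_
    have := (proj_deriv i x).pow 2
    simpa using this
  have h2 : (∑ i ∈ T, (x i)^2) ≠ 0 := by
    rw [← rT_sq]; positivity
  have h3 := h1.sqrt h2
  refine h3.congr_fderiv ?_
  unfold drT
  rw [Finset.smul_sum]
  refine Finset.sum_congr rfl fun i _ => ?_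
  rw [smul_smul]
  congr 1
  change 1 / (2 * rT T x) * (2 * x i) = _
  field_simp

/-- component of the derivative of `rT` -/
def drc {d : ℕ} (T : Finset (Fin d)) (x : E d) (j : Fin d) : ℝ := if j ∈ T then x j / rT T x else 0

lemma drT_apply {d : ℕ} (T : Finset (Fin d)) (x : E d) (j : Fin d) :
    drT T x (EuclideanSpace.single j 1) = drc T x j := by
  unfold drT drc
  rw [_root_.sum_apply]
  simp only [_root_.smul_apply, proj_single, smul_eq_mul, mul_ite, mul_one, mul_zero]
  rw [Finset.sum_ite_eq]

lemma drc_le {d : ℕ} (T : Finset (Fin d)) (x : E d) (j : Fin d) : |drc T x j| ≤ 1 := by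
  unfold drc
  split_ifs with h
  · rw [abs_div, abs_of_nonneg (rT_nonneg T x)]
    exact div_le_one_of_le₀ (abs_le_rT h x) (rT_nonneg T x)
  · simp

/-- averaged Cantor function -/
def psi {d : ℕ} (F : ℝ → ℝ) (σ : Fin d) (T : Finset (Fin d)) (x : E d) : ℝ :=
  if rT T x = 0 then F (x σ) else pz F (x σ) (rT T x)

/-- difference quotient -/
def Qf {d : ℕ} (F : ℝ → ℝ) (σ : Fin d) (T : Finset (Fin d)) (x : E d) : ℝ :=
  (F (x σ + rT T x) - F (x σ - rT T x)) / (2 * rT T x)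

/-- radial field -/
def MM {d : ℕ} (D c : ℝ) (F : ℝ → ℝ) (σ : Fin d) (T : Finset (Fin d)) (i : Fin d) (x : E d) : ℝ :=
  x i * rT T x ^ (-(T.card:ℝ)) * th D c F (x σ) (rT T x)

section
variable {d : ℕ} {D C c : ℝ} {F : ℝ → ℝ} (hF : CF D C c F) {σ : Fin d} {T : Finset (Fin d)}
include hF

lemma F_mem (s : ℝ) : 0 ≤ F s ∧ F s ≤ 1 := by
  constructor
  · rcases le_or_gt s 0 with h | h
    · rw [hF.zero s h]
    · exact (hF.pos s h).le
  · have := hF.mono (le_max_left s (1/4))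
    rwa [hF.one _ (le_max_right _ _)] at this

lemma Qf_nonneg (x : E d) : 0 ≤ Qf F σ T x := by
  have := rT_nonneg T x
  have h := hF.mono (show x σ - rT T x ≤ x σ + rT T x by linarith)
  exact div_nonneg (by linarith) (by linarith)

lemma Qf_le {x : E d} (hr : 0 < rT T x) : Qf F σ T x ≤ C * rT T x ^ (D - 1) := by
  unfold Qf
  rw [div_le_iff₀ (by positivity), mul_assoc, Real.rpow_sub_one hr.ne']
  have := hF.up (x σ) _ hr
  have h2 : rT T x ^ D / rT T x * (2 * rT T x) = 2 * rT T x ^ D := by field_simp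
  rw [h2]
  have : 0 < C * rT T x ^ D := mul_pos hF.C0 (by positivity)
  linarith

lemma Qf_zero {x : E d} (h : x ∉ regA F σ T 1) : Qf F σ T x = 0 := by
  have h0 := Qf_nonneg hF (σ := σ) (T := T) x
  refine le_antisymm ?_ h0
  simp only [regA, mem_ofPred_eq, one_mul, not_lt] at h
  have := rT_nonneg T x
  exact div_nonpos_of_nonpos_of_nonneg (by linarith) (by linarith)

lemma regA_mono {x : E d} (h : x ∈ regA F σ T 1) : x ∈ regA F σ T 3 := by
  simp only [regA, mem_ofPred_eq, one_mul] at h ⊢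
  have := rT_nonneg T x
  have h1 := hF.mono (show x σ - 3 * rT T x ≤ x σ - rT T x by linarith)
  have h2 := hF.mono (show x σ + rT T x ≤ x σ + 3 * rT T x by linarith)
  linarith

lemma regA_pos {x : E d} (h : x ∈ regA F σ T 1) : 0 < rT T x := by
  rcases (rT_nonneg T x).eq_or_lt with h0 | h0
  · simp [regA, ← h0] at h
  · exact h0

lemma psi_mem (x : E d) : 0 ≤ psi F σ T x ∧ psi F σ T x ≤ 1 := by
  unfold psi
  split_ifs with h
  · exact F_mem hF _
  · have h0 : 0 < rT T x := lt_of_le_of_ne (rT_nonneg T x) (Ne.symm h)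
    have := pz_mem hF.cont hF.mono (s := x σ) h0
    exact ⟨(F_mem hF _).1.trans this.1, this.2.trans (F_mem hF _).2⟩

lemma psi_meas : Measurable (psi F σ T) := by
  unfold psi pz
  have h1 := (rT_cont T).measurable
  have h2 : Measurable (Hf F) :=
    (Differentiable.continuous fun s => (Hf_deriv hF.cont s).differentiableAt).measurable
  have h3 := hF.cont.measurable
  have h4 : Measurable fun x : E d => x σ := by fun_prop
  refine Measurable.ite (h1 (measurableSet_singleton 0)) (h3.comp h4) ?_
  exact ((h2.comp (h4.add h1)).sub (h2.comp (h4.sub h1))).div (h1.const_mul 2)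

lemma MM_meas (i : Fin d) : Measurable (MM D c F σ T i) := by
  unfold MM th qz
  have h1 := (rT_cont T).measurable
  have h2 : Measurable (Hf F) :=
    (Differentiable.continuous fun s => (Hf_deriv hF.cont s).differentiableAt).measurable
  have h4 : ∀ σ, Measurable fun x : E d => x σ := fun σ => by fun_prop
  have h5 : Measurable Real.smoothTransition := Real.smoothTransition.continuous.measurable
  have e := h4 σ
  refine ((h4 i).mul (h1.pow_const _)).mul (h5.comp (((h1.pow_const _).mul ?_).const_mul _))
  refine Measurable.div ?_ h1
  exact ((h2.comp (e.add (h1.const_mul 3))).sub (h2.comp (e.add (h1.const_mul 2)))).sub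
    ((h2.comp (e.sub (h1.const_mul 2))).sub (h2.comp (e.sub (h1.const_mul 3))))

lemma near_good {x : E d} (hx : x ∉ badZ F σ T) (h0 : rT T x = 0) :
    ∀ᶠ y in 𝓝 x, ∀ t, |t - y σ| ≤ 3 * rT T y → F t = F (x σ) := by
  have : ∃ δ > 0, ¬ F (x σ - δ) < F (x σ + δ) := by
    by_contra hc
    push Not at hc
    exact hx ⟨h0, hc⟩
  obtain ⟨δ, hδ, hle⟩ := this
  have hc : Continuous fun y : E d => |y σ - x σ| + 3 * rT T y := by
    have := rT_cont T
    fun_prop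
  have hlt : |x σ - x σ| + 3 * rT T x < δ := by rw [h0]; simpa using hδ
  filter_upwards [(isOpen_lt hc continuous_const).mem_nhds hlt] with y hy t ht
  have hy : |y σ - x σ| + 3 * rT T y < δ := hy
  have h1 := abs_le.1 ht
  have h2 := abs_le.1 (le_refl |y σ - x σ|)
  have e1 := hF.mono (show x σ - δ ≤ t by linarith)
  have e2 := hF.mono (show t ≤ x σ + δ by linarith)
  have e3 := hF.mono (show x σ - δ ≤ x σ by linarith)
  have e4 := hF.mono (show x σ ≤ x σ + δ by linarith)
  linarith

lemma psi_pd {x : E d} (hx : x ∉ badZ F σ T) : DifferentiableAt ℝ (psi F σ T) x ∧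
    ∃ B, |B| ≤ Qf F σ T x ∧ ∀ j, pd (psi F σ T) j x = (if j = σ then Qf F σ T x else 0) + B * drc T x j := by
  rcases (rT_nonneg T x).eq_or_lt with h0 | h0
  · have he : psi F σ T =ᶠ[𝓝 x] fun _ => F (x σ) := by
      filter_upwards [near_good hF hx h0.symm] with y hy
      unfold psi
      split_ifs with h
      · exact hy _ (by simp [h])
      · have hr : 0 < rT T y := lt_of_le_of_ne (rT_nonneg T y) (Ne.symm h)
        have := pz_mem hF.cont hF.mono (s := y σ) hr
        rw [hy (y σ - rT T y) (by rw [abs_le]; constructor <;> linarith),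
          hy (y σ + rT T y) (by rw [abs_le]; constructor <;> linarith)] at this
        exact le_antisymm this.2 this.1
    have hQ : Qf F σ T x = 0 := by simp [Qf, ← h0]
    refine ⟨(differentiableAt_const _).congr_of_eventuallyEq he, 0, by simp [hQ], fun j => ?_⟩
    rw [pd_const he, hQ]; simp
  · have he : psi F σ T =ᶠ[𝓝 x] fun y => pz F (y σ) (rT T y) := by
      filter_upwards [(isOpen_lt continuous_const (rT_cont T)).mem_nhds h0] with y hy
      have hy : 0 < rT T y := hy
      simp [psi, hy.ne']
    obtain ⟨B, hB, hBb⟩ := pz_deriv hF.cont hF.mono (proj_deriv σ x) (rT_deriv h0) h0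
    refine ⟨hB.differentiableAt.congr_of_eventuallyEq he, B, hBb, fun j => ?_⟩
    rw [pd_congr he]
    unfold pd
    rw [hB.fderiv]
    simp only [_root_.add_apply, _root_.smul_apply, proj_single, drT_apply,
      smul_eq_mul, Qf]
    split_ifs <;> simp

lemma th_mem (s r : ℝ) : |th D c F s r| ≤ 1 := by
  unfold th
  rw [abs_of_nonneg (Real.smoothTransition.nonneg _)]
  exact Real.smoothTransition.le_one _

omit hF in
lemma base_deriv {x : E d} (h0 : 0 < rT T x) (i : Fin d) :
    HasFDerivAt (fun y : E d => y i * rT T y ^ (-(T.card:ℝ)))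
      (x i • ((-(T.card:ℝ) * rT T x ^ (-(T.card:ℝ) - 1)) • drT T x) +
        rT T x ^ (-(T.card:ℝ)) • (EuclideanSpace.proj i : E d →L[ℝ] ℝ)) x :=
  (proj_deriv i x).mul ((rT_deriv h0).rpow_const (Or.inl h0.ne'))

lemma MM_zero {x : E d} (i : Fin d) (h0 : 0 < rT T x) (h : x ∉ regA F σ T 3) : MM D c F σ T i x = 0 := by
  unfold MM
  rw [th_zero hF h0 h, mul_zero]

lemma MM_le {x : E d} {i : Fin d} (hi : i ∈ T) (h0 : 0 < rT T x) :
    |MM D c F σ T i x| ≤ rT T x ^ (1 - (T.card:ℝ)) := by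
  unfold MM
  rw [abs_mul, abs_mul, abs_of_nonneg (Real.rpow_nonneg h0.le _), sub_eq_add_neg, Real.rpow_add h0,
    Real.rpow_one]
  have h1 := abs_le_rT hi x
  have h2 := th_mem hF (x σ) (rT T x)
  have h3 : 0 ≤ rT T x ^ (-(T.card:ℝ)) := Real.rpow_nonneg h0.le _
  calc _ ≤ rT T x * rT T x ^ (-(T.card:ℝ)) * 1 := by gcongr
    _ = _ := mul_one _

lemma MM_pd : ∃ K, 0 < K ∧ ∀ x ∉ badZ F σ T, ∀ i ∈ T, DifferentiableAt ℝ (MM D c F σ T i) x ∧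
    ∀ j, |pd (MM D c F σ T i) j x| ≤ K * rT T x ^ (-(T.card:ℝ)) ∧
      (x ∉ regA F σ T 3 → pd (MM D c F σ T i) j x = 0) := by
  obtain ⟨K, hK, hKd⟩ := th_deriv hF
  have hk : (0:ℝ) ≤ T.card := Nat.cast_nonneg _
  refine ⟨2 * K + (1 + T.card), by positivity, ?_⟩
  intro x hx i hi
  rcases (rT_nonneg T x).eq_or_lt with h0 | h0
  · have he : MM D c F σ T i =ᶠ[𝓝 x] fun _ => 0 := by
      filter_upwards [near_good hF hx h0.symm] with y hy
      rcases (rT_nonneg T y).eq_or_lt with h | h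
      · have := abs_le_rT hi y
        rw [← h] at this
        have : y i = 0 := abs_nonpos_iff.1 this
        simp [MM, this]
      · refine MM_zero hF i h ?_
        simp only [regA, mem_ofPred_eq]
        rw [hy (y σ - 3 * rT T y) (by rw [abs_le]; constructor <;> linarith),
          hy (y σ + 3 * rT T y) (by rw [abs_le]; constructor <;> linarith)]
        exact lt_irrefl _
    refine ⟨(differentiableAt_const _).congr_of_eventuallyEq he, fun j => ?_⟩
    rw [pd_const he]
    refine ⟨?_, fun _ => rfl⟩
    rw [abs_zero]
    have : 0 ≤ rT T x ^ (-(T.card:ℝ)) := Real.rpow_nonneg (rT_nonneg _ _) _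
    positivity
  · obtain ⟨A, B, hd, hA, hB, hz⟩ := hKd (proj_deriv σ x) (rT_deriv h0) h0
    have hm := (base_deriv h0 i).mul hd
    refine ⟨hm.differentiableAt, fun j => ?_⟩
    have e : pd (MM D c F σ T i) j x =
        x i * rT T x ^ (-(T.card:ℝ)) * (A * (if j = σ then 1 else 0) + B * drc T x j) +
        th D c F (x σ) (rT T x) * (x i * ((-(T.card:ℝ) * rT T x ^ (-(T.card:ℝ) - 1)) * drc T x j) +
          rT T x ^ (-(T.card:ℝ)) * (if j = i then 1 else 0)) := by
      have hm' : HasFDerivAt (MM D c F σ T i) _ x := hm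
      unfold pd
      rw [hm'.fderiv]
      simp only [_root_.add_apply, _root_.smul_apply, proj_single, drT_apply,
        smul_eq_mul]
    rw [e]
    constructor
    · set R := rT T x ^ (-(T.card:ℝ)) with hR
      have hR0 : 0 ≤ R := Real.rpow_nonneg h0.le _
      have e2 : rT T x ^ (-(T.card:ℝ) - 1) = R / rT T x := Real.rpow_sub_one h0.ne' _
      rw [e2]
      have h1 : |A * (if j = σ then (1:ℝ) else 0) + B * drc T x j| ≤ 2 * K / rT T x := by
        refine (abs_add_le _ _).trans ?_
        rw [abs_mul, abs_mul]
        have q1 : |(if j = σ then (1:ℝ) else 0)| ≤ 1 := by split_ifs <;> simp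
        have q2 := drc_le T x j
        have q3 : 0 ≤ K / rT T x := by positivity
        have q4 := mul_le_mul hA q1 (abs_nonneg _) q3
        have q5 := mul_le_mul hB q2 (abs_nonneg _) q3
        have : 2 * K / rT T x = K / rT T x + K / rT T x := by ring
        linarith
      have hxi := abs_le_rT hi x
      have h2 : |x i * R * (A * (if j = σ then (1:ℝ) else 0) + B * drc T x j)| ≤ 2 * K * R := by
        rw [abs_mul, abs_mul, abs_of_nonneg hR0]
        calc _ ≤ rT T x * R * (2 * K / rT T x) := by gcongr
          _ = _ := by field_simp
      have h3 : |x i * (-(T.card:ℝ) * (R / rT T x) * drc T x j) + R * (if j = i then (1:ℝ) else 0)|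
          ≤ T.card * R + R := by
        refine (abs_add_le _ _).trans (add_le_add ?_ ?_)
        · rw [abs_mul, abs_mul, abs_mul, abs_neg, abs_of_nonneg hk, abs_of_nonneg (by positivity : 0 ≤ R / rT T x)]
          calc _ ≤ rT T x * (T.card * (R / rT T x) * 1) := by
                have := drc_le T x j
                gcongr
            _ = _ := by field_simp
        · rw [abs_mul, abs_of_nonneg hR0]
          have q1 : |(if j = i then (1:ℝ) else 0)| ≤ 1 := by split_ifs <;> simp
          nlinarith
      have h4 := th_mem hF (x σ) (rT T x)
      refine (abs_add_le _ _).trans ?_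
      rw [abs_mul (th D c F (x σ) (rT T x))]
      have h5 := mul_le_mul h4 h3 (abs_nonneg _) zero_le_one
      linarith
    · intro hA3
      obtain ⟨rfl, rfl⟩ := hz hA3
      rw [th_zero hF h0 hA3]; simp

lemma MM_in {x : E d} (hx : x ∈ regA F σ T 1) (h1 : rT T x < 1) (i j : Fin d) :
    pd (MM D c F σ T i) j x = rT T x ^ (-(T.card:ℝ)) *
      ((if j = i then 1 else 0) - T.card * (x i / rT T x) * drc T x j) := by
  have h0 := regA_pos hF hx
  have he : MM D c F σ T i =ᶠ[𝓝 x] fun y : E d => y i * rT T y ^ (-(T.card:ℝ)) := by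
    filter_upwards [(regA_open hF.cont σ T 1).mem_nhds hx,
      (isOpen_lt (rT_cont T) continuous_const).mem_nhds h1] with y hy hy1
    have hy1 : rT T y < 1 := hy1
    unfold MM
    rw [th_one hF (regA_pos hF hy) hy1.le, mul_one]
    simpa [regA] using hy
  rw [pd_congr he]
  have hb := base_deriv h0 i
  unfold pd
  rw [hb.fderiv]
  simp only [_root_.add_apply, _root_.smul_apply, proj_single, drT_apply,
        smul_eq_mul]
  rw [Real.rpow_sub_one h0.ne']
  ring

lemma MM_div {x : E d} (hx : x ∈ regA F σ T 1) (h1 : rT T x < 1) :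
    ∑ i ∈ T, pd (MM D c F σ T i) i x = 0 := by
  have h0 := regA_pos hF hx
  have e : ∀ i ∈ T, pd (MM D c F σ T i) i x = rT T x ^ (-(T.card:ℝ)) *
      (1 - T.card * ((x i)^2 / rT T x ^ 2)) := by
    intro i hi
    rw [MM_in hF hx h1]
    simp only [drc, if_pos hi, if_true]
    ring
  rw [Finset.sum_congr rfl e, ← Finset.mul_sum, Finset.sum_sub_distrib, ← Finset.mul_sum,
    ← Finset.sum_div, ← rT_sq, div_self (by positivity)]
  simp

lemma MM_off {x : E d} (hx : x ∈ regA F σ T 1) (h1 : rT T x < 1) {i j : Fin d} (hi : i ∈ T) (hj : j ∉ T) :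
    pd (MM D c F σ T i) j x = 0 := by
  rw [MM_in hF hx h1, if_neg (show ¬ j = i from fun h => hj (h ▸ hi))]
  simp [drc, hj]

end



/-- outer cut-off -/
def ch1 (d : ℕ) : E d → ℝ := cut Finset.univ (7/10)

/-- inner cut-off -/
def ch2 {d : ℕ} (σ : Fin d) : E d → ℝ := cut (Finset.univ.erase σ) (1 / (16 * d))

def PP {d : ℕ} (F : ℝ → ℝ) (σ : Fin d) (T : Finset (Fin d)) (x : E d) : ℝ := psi F σ T x * ch1 d x

def NN {d : ℕ} (D c : ℝ) (F : ℝ → ℝ) (σ : Fin d) (T : Finset (Fin d)) (i : Fin d) (x : E d) : ℝ :=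
  MM D c F σ T i x * ch2 σ x

lemma dpos {d : ℕ} (σ : Fin d) : (1:ℝ) ≤ d := by
  have : 1 ≤ d := Fin.pos σ
  exact_mod_cast this

lemma rho_pos {d : ℕ} (σ : Fin d) : (0:ℝ) < 1 / (16 * d) := by
  have := dpos σ; positivity

lemma ch2_far {d : ℕ} (σ : Fin d) (x : E d) :
    ch2 σ =ᶠ[𝓝 x] (fun _ => 0) ∨ ∀ i ≠ σ, |x i| ≤ 1 / (8 * d) := by
  by_cases h : ∀ i ≠ σ, |x i| ≤ 1 / (8 * d)
  · exact Or.inr h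
  · left
    push Not at h
    obtain ⟨i, hi, hx⟩ := h
    refine cut_zero _ (rho_pos σ) (i := i) (by simp [hi]) ?_
    have hd := dpos σ
    have h1 : (1 / (8 * (d:ℝ)))^2 < (x i)^2 := sq_lt_sq.2 (by rwa [abs_of_pos (by positivity)])
    have h2 : 2 * (1 / (16 * (d:ℝ)))^2 ≤ (1 / (8 * (d:ℝ)))^2 := by
      have : (1 / (8 * (d:ℝ))) = 2 * (1 / (16 * (d:ℝ))) := by field_simp; norm_num
      rw [this]
      nlinarith [sq_nonneg (1 / (16 * (d:ℝ)))]
    linarith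

section
variable {d : ℕ} {D C c : ℝ} {F : ℝ → ℝ} (hF : CF D C c F) {σ : Fin d} {T : Finset (Fin d)} (hσ : σ ∉ T)

include hσ in
lemma rT_small {x : E d} (h : ∀ i ≠ σ, |x i| ≤ 1 / (8 * d)) : rT T x ≤ 1/8 := by
  have hd := dpos σ
  have := rT_le (T := T) (x := x) (M := 1 / (8 * d)) (by positivity)
    (fun i hi => h i (fun e => hσ (e ▸ hi)))
  refine this.trans (le_of_eq ?_)
  field_simp

include hF in
lemma s_small {x : E d} (hx : x ∈ regA F σ T 3) (hr : rT T x ≤ 1/8) : |x σ| ≤ 5/8 := by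
  have hx : F (x σ - 3 * rT T x) < F (x σ + 3 * rT T x) := hx
  rw [abs_le]
  constructor
  · by_contra hc
    push Not at hc
    rw [hF.zero (x σ + 3 * rT T x) (by linarith)] at hx
    exact absurd hx (not_lt.2 (F_mem hF _).1)
  · by_contra hc
    push Not at hc
    rw [hF.one (x σ - 3 * rT T x) (by linarith)] at hx
    exact absurd hx (not_lt.2 (F_mem hF _).2)

include hF in
lemma PP_diff {x : E d} (hx : x ∉ badZ F σ T) : DifferentiableAt ℝ (PP F σ T) x :=
  (psi_pd hF hx).1.mul (cut_diff _ _ x)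

include hF in
lemma PP_pd {x : E d} (hx : x ∉ badZ F σ T) (j : Fin d) :
    pd (PP F σ T) j x = psi F σ T x * pd (ch1 d) j x + ch1 d x * pd (psi F σ T) j x :=
  pd_mul (psi_pd hF hx).1 (cut_diff _ _ x) j

include hF in
lemma NN_diff {x : E d} (hx : x ∉ badZ F σ T) {i : Fin d} (hi : i ∈ T) :
    DifferentiableAt ℝ (NN D c F σ T i) x := by
  obtain ⟨K, -, h⟩ := MM_pd hF (σ := σ) (T := T)
  exact (h x hx i hi).1.mul (cut_diff _ _ x)

include hF in
lemma NN_pd {x : E d} (hx : x ∉ badZ F σ T) {i : Fin d} (hi : i ∈ T) (j : Fin d) :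
    pd (NN D c F σ T i) j x = MM D c F σ T i x * pd (ch2 σ) j x + ch2 σ x * pd (MM D c F σ T i) j x := by
  obtain ⟨K, -, h⟩ := MM_pd hF (σ := σ) (T := T)
  exact pd_mul (h x hx i hi).1 (cut_diff _ _ x) j

include hF in
lemma psi_pd_le {x : E d} (hx : x ∉ badZ F σ T) (j : Fin d) : |pd (psi F σ T) j x| ≤ 2 * Qf F σ T x := by
  obtain ⟨B, hB, h⟩ := (psi_pd hF hx).2
  rw [h j]
  have hQ := Qf_nonneg hF (σ := σ) (T := T) x
  refine (abs_add_le _ _).trans ?_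
  have h1 : |if j = σ then Qf F σ T x else 0| ≤ Qf F σ T x := by
    split_ifs
    · rw [abs_of_nonneg hQ]
    · simpa using hQ
  rw [abs_mul]
  have := mul_le_mul hB (drc_le T x j) (abs_nonneg _) hQ
  linarith

include hF in
lemma PP_bd : ∃ M, 0 < M ∧ ∀ x ∈ cube d, 0 < rT T x → ∀ j,
    (x ∈ regA F σ T 1 ∧ |pd (PP F σ T) j x| ≤ M * rT T x ^ (D - 1)) ∨
    (x ∉ regA F σ T 1 ∧ |pd (PP F σ T) j x| ≤ M) := by
  obtain ⟨M, hM, hMb⟩ := cut_pd_bd (Finset.univ : Finset (Fin d)) (ρ := 7/10) (by norm_num)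
  have hd := dpos σ
  have hC := hF.C0
  have hD1 := hF.D1
  refine ⟨max M (M * (d:ℝ) ^ (1 - D) + 2 * C), by positivity, ?_⟩
  intro x hx hr j
  have hZ : x ∉ badZ F σ T := fun h => hr.ne' h.1
  have hp := psi_mem hF (σ := σ) (T := T) x
  have h1 : |pd (PP F σ T) j x| ≤ M + 2 * Qf F σ T x := by
    rw [PP_pd hF hZ]
    refine (abs_add_le _ _).trans ?_
    rw [abs_mul, abs_mul, abs_of_nonneg hp.1, abs_of_nonneg (show 0 ≤ ch1 d x from cut_nonneg _ _ x)]
    have q1 := mul_le_mul hp.2 (hMb x j) (abs_nonneg _) zero_le_one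
    have q2 := mul_le_mul (show ch1 d x ≤ 1 from cut_le_one _ _ x) (psi_pd_le hF hZ j) (abs_nonneg _) zero_le_one
    rw [one_mul] at q1 q2
    exact add_le_add q1 q2
  by_cases hA : x ∈ regA F σ T 1
  · left
    refine ⟨hA, h1.trans ?_⟩
    have hQ := Qf_le hF (σ := σ) hr
    have e : 1 ≤ (d:ℝ) ^ (1 - D) * rT T x ^ (D - 1) := by
      have h2 : rT T x ^ (D - 1) = (rT T x ^ (1 - D))⁻¹ := by
        rw [← Real.rpow_neg hr.le]; congr 1; ring
      rw [h2, ← div_eq_mul_inv, one_le_div (by positivity)]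
      exact Real.rpow_le_rpow hr.le (rT_le_cube hx) (by linarith)
    calc M + 2 * Qf F σ T x ≤ (M * (d:ℝ) ^ (1 - D) + 2 * C) * rT T x ^ (D - 1) := by nlinarith
      _ ≤ _ := by gcongr; exact le_max_right _ _
  · right
    refine ⟨hA, h1.trans ?_⟩
    rw [Qf_zero hF hA]
    simp

include hF in
lemma NN_bd : ∃ M, 0 < M ∧ ∀ x ∈ cube d, 0 < rT T x → ∀ i ∈ T, ∀ j,
    |pd (NN D c F σ T i) j x| ≤ M * rT T x ^ (-(T.card:ℝ)) ∧
    (x ∉ regA F σ T 3 → pd (NN D c F σ T i) j x = 0) := by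
  obtain ⟨M, hM, hMb⟩ := cut_pd_bd (Finset.univ.erase σ) (rho_pos σ)
  obtain ⟨K, hK, hKb⟩ := MM_pd hF (σ := σ) (T := T)
  have hd := dpos σ
  refine ⟨d * M + K, by positivity, ?_⟩
  intro x hx hr i hi j
  have hZ : x ∉ badZ F σ T := fun h => hr.ne' h.1
  rw [NN_pd hF hZ hi]
  have hk := (hKb x hZ i hi).2 j
  constructor
  · refine (abs_add_le _ _).trans ?_
    rw [abs_mul, abs_mul, abs_of_nonneg (show 0 ≤ ch2 σ x from cut_nonneg _ _ x), add_mul]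
    have hR : 0 < rT T x ^ (-(T.card:ℝ)) := by positivity
    refine add_le_add ?_ ?_
    · have := MM_le hF (σ := σ) hi hr
      rw [sub_eq_add_neg, Real.rpow_add hr, Real.rpow_one] at this
      calc _ ≤ (rT T x * rT T x ^ (-(T.card:ℝ))) * M := by gcongr; exact hMb x j
        _ ≤ (d * rT T x ^ (-(T.card:ℝ))) * M := by gcongr; exact rT_le_cube hx
        _ = _ := by ring
    · have := mul_le_mul (show ch2 σ x ≤ 1 from cut_le_one _ _ x) hk.1 (abs_nonneg _) zero_le_one
      linarith
  · intro hA
    rw [MM_zero hF i hr hA, hk.2 hA]; simp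

include hF in
lemma MM_val {x : E d} (hx : x ∈ regA F σ T 1) (h1 : rT T x < 1) (i : Fin d) :
    MM D c F σ T i x = x i * rT T x ^ (-(T.card:ℝ)) := by
  unfold MM
  rw [th_one hF (regA_pos hF hx) h1.le, mul_one]
  simpa [regA] using hx

lemma NN_loc {x : E d} (h : ch2 σ =ᶠ[𝓝 x] (fun _ => 0)) (i j : Fin d) : pd (NN D c F σ T i) j x = 0 := by
  refine pd_const (a := 0) ?_ j
  filter_upwards [h] with y hy
  simp [NN, hy]

include hF hσ in
lemma NN_in {x : E d} (hx : x ∈ regA F σ T 1) (hr : rT T x < 1) :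
    (∑ i ∈ T, pd (NN D c F σ T i) i x = rT T x ^ (-(T.card:ℝ)) * ∑ i ∈ T, x i * pd (ch2 σ) i x) ∧
    ∀ i ∈ T, ∀ j ∉ T, pd (NN D c F σ T i) j x = x i * rT T x ^ (-(T.card:ℝ)) * pd (ch2 σ) j x := by
  have h0 := regA_pos hF hx
  have hZ : x ∉ badZ F σ T := fun h => h0.ne' h.1
  constructor
  · rw [Finset.sum_congr rfl fun i hi => NN_pd hF hZ hi i, Finset.sum_add_distrib, ← Finset.mul_sum,
      MM_div hF hx hr, mul_zero, add_zero, Finset.mul_sum]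
    refine Finset.sum_congr rfl fun i _ => ?_
    rw [MM_val hF hx hr]; ring
  · intro i hi j hj
    rw [NN_pd hF hZ hi, MM_off hF hx hr hi hj, MM_val hF hx hr, mul_zero, add_zero]

lemma ch2_σ (x : E d) : pd (ch2 σ) σ x = 0 := cut_pd_notMem _ (by simp) _ _

/-- the radial derivative -/
lemma rad_bd (hT : T.Nonempty) : ∃ M, 0 < M ∧ ∀ x : E d, 0 < rT T x →
    |rT T x ^ (-(T.card:ℝ)) * ∑ i ∈ T, x i * pd (ch2 σ) i x| ≤ M := by
  obtain ⟨M, hM, hMb⟩ := cut_pd_bd (Finset.univ.erase σ) (rho_pos σ)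
  have hk : (1:ℝ) ≤ T.card := by exact_mod_cast hT.card_pos
  have hρ := rho_pos σ
  set ρ : ℝ := 1 / (16 * d) with hρe
  refine ⟨T.card * (ρ ^ (1 - (T.card:ℝ)) * M), by positivity, ?_⟩
  intro x hr
  rw [Finset.mul_sum]
  refine (Finset.abs_sum_le_sum_abs _ _).trans ?_
  rw [← nsmul_eq_mul, ← Finset.sum_const]
  refine Finset.sum_le_sum fun i hi => ?_
  rcases lt_or_ge |x i| ρ with h | h
  · have : pd (ch2 σ) i x = 0 := cut_pd_near _ hρ h
    rw [this]; simp; positivity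
  · have hxi := abs_le_rT hi x
    rw [abs_mul, abs_mul, abs_of_pos (by positivity : 0 < rT T x ^ (-(T.card:ℝ))), ← mul_assoc]
    refine mul_le_mul ?_ (hMb x i) (abs_nonneg _) (by positivity)
    calc rT T x ^ (-(T.card:ℝ)) * |x i| ≤ rT T x ^ (-(T.card:ℝ)) * rT T x := by gcongr
      _ = rT T x ^ (1 - (T.card:ℝ)) := by rw [sub_eq_add_neg, Real.rpow_add hr, Real.rpow_one]; ring
      _ ≤ _ := Real.rpow_le_rpow_of_nonpos hρ (h.trans hxi) (by linarith)

include hF hσ in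
lemma NN_in_bd (hT : T.Nonempty) : ∃ M, 0 < M ∧ ∀ x ∈ regA F σ T 1,
    |∑ i ∈ T, pd (NN D c F σ T i) i x| ≤ M ∧
    (∀ i ∈ T, pd (NN D c F σ T i) σ x = 0) ∧
    ∀ i ∈ T, ∀ j ∉ T, |pd (NN D c F σ T i) j x| ≤ M * rT T x ^ (1 - (T.card:ℝ)) := by
  obtain ⟨M, hM, hMb⟩ := cut_pd_bd (Finset.univ.erase σ) (rho_pos σ)
  obtain ⟨M', hM', hMb'⟩ := rad_bd (σ := σ) hT
  refine ⟨max M M', by positivity, fun x hx => ?_⟩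
  have h0 := regA_pos hF hx
  rcases ch2_far σ x with h | h
  · simp only [NN_loc h]
    refine ⟨by simp; left; exact hM.le, fun _ _ => trivial, fun _ _ _ _ => by rw [abs_zero]; positivity⟩
  · have hr : rT T x < 1 := by linarith [rT_small hσ h]
    obtain ⟨h1, h2⟩ := NN_in hF hσ hx hr
    refine ⟨?_, fun i hi => ?_, fun i hi j hj => ?_⟩
    · rw [h1]; exact (hMb' x h0).trans (le_max_right _ _)
    · rw [h2 i hi σ hσ, ch2_σ, mul_zero]
    · rw [h2 i hi j hj, abs_mul, abs_mul, abs_of_pos (by positivity : 0 < rT T x ^ (-(T.card:ℝ))),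
        sub_eq_add_neg, Real.rpow_add h0, Real.rpow_one, mul_comm]
      have := abs_le_rT hi x
      refine mul_le_mul ((hMb x j).trans (le_max_left _ _)) ?_ (by positivity) (by positivity)
      gcongr

include hF hσ in
lemma pairing {x : E d} (hr : 0 < rT T x) :
    ∑ i ∈ T, (pd (NN D c F σ T i) i x * pd (PP F σ T) σ x - pd (NN D c F σ T i) σ x * pd (PP F σ T) i x) =
    rT T x ^ (-(T.card:ℝ)) * (∑ i ∈ T, x i * pd (ch2 σ) i x) * Qf F σ T x := by
  have hZ : x ∉ badZ F σ T := fun h => hr.ne' h.1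
  rcases ch2_far σ x with h | h
  · simp only [NN_loc h, pd_const h]; simp
  have hr8 := rT_small hσ h
  by_cases h3 : x ∈ regA F σ T 3
  swap
  · have h1 : x ∉ regA F σ T 1 := fun h => h3 (regA_mono hF h)
    rw [Qf_zero hF h1, mul_zero]
    obtain ⟨K, hK, hKb⟩ := MM_pd hF (σ := σ) (T := T)
    refine Finset.sum_eq_zero fun i hi => ?_
    have e : ∀ j, pd (NN D c F σ T i) j x = 0 := fun j => by
      rw [NN_pd hF hZ hi, MM_zero hF i hr h3, ((hKb x hZ i hi).2 j).2 h3]; simp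
    rw [e, e]; simp
  have hs := s_small hF h3 hr8
  have hd := dpos σ
  have hall : ∀ i, |x i| < 7/10 := by
    intro i
    by_cases hi : i = σ
    · rw [hi]; linarith
    · refine (h i hi).trans_lt ?_
      rw [div_lt_iff₀ (by positivity)]; nlinarith
  have hch : ch1 d =ᶠ[𝓝 x] fun _ => 1 := cut_one _ (by norm_num) fun i _ => hall i
  have hP : ∀ j, pd (PP F σ T) j x = pd (psi F σ T) j x := by
    intro j
    rw [PP_pd hF hZ, pd_const hch, hch.self_of_nhds]; simp
  simp only [hP]
  by_cases h1 : x ∈ regA F σ T 1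
  · obtain ⟨e1, e2⟩ := NN_in hF hσ h1 (show rT T x < 1 by linarith)
    obtain ⟨B, -, hB⟩ := (psi_pd hF hZ).2
    have e3 : pd (psi F σ T) σ x = Qf F σ T x := by
      rw [hB]; simp [drc, hσ]
    rw [Finset.sum_sub_distrib, ← Finset.sum_mul, e1, e3, sub_eq_self]
    refine Finset.sum_eq_zero fun i hi => ?_
    rw [e2 i hi σ hσ, ch2_σ]; simp
  · have e : ∀ j, pd (psi F σ T) j x = 0 := by
      intro j
      have := psi_pd_le hF hZ j
      rw [Qf_zero hF h1, mul_zero] at this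
      exact abs_nonpos_iff.1 this
    simp only [e, Qf_zero hF h1]; simp

end



section
variable {n : ℕ} {D C c : ℝ} {F : ℝ → ℝ} (hF : CF D C c F) {σ : Fin (n+1)} {T : Finset (Fin (n+1))}
  (hσ : σ ∉ T) (hT : T.Nonempty)
include hF hσ hT

lemma PP_nice : Nice (badZ F σ T) (PP F σ T) := by
  have hk : (0:ℝ) < T.card := by exact_mod_cast hT.card_pos
  have hs : ∀ x ∉ KK (n+1), PP F σ T x = 0 := by
    intro x hx
    have : ∃ i, 99/100 < |x i| := by
      by_contra hc
      push Not at hc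
      exact hx hc
    obtain ⟨i, hi⟩ := this
    have h2 : ch1 (n+1) x = 0 := by
      refine Finset.prod_eq_zero (Finset.mem_univ i) (bump_zero (by norm_num) ?_)
      have : (99/100:ℝ)^2 < (x i)^2 := sq_lt_sq.2 (by rwa [abs_of_pos (by norm_num)])
      linarith
    simp [PP, h2]
  obtain ⟨M, hM, hb⟩ := PP_bd hF (σ := σ) (T := T)
  refine ⟨fun x hx => PP_diff hF hx, ?_, fun j => ?_, hs⟩
  · refine int_dom1 hF hT hσ (a2 := 0) (M := 1) zero_le_one
      ((psi_meas hF).mul (cut_contDiff _ _).continuous.measurable) hs ?_ (by linarith [hF.D1])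
    intro x _ _
    left
    have h1 := psi_mem hF (σ := σ) (T := T) x
    have h2 : 0 ≤ ch1 (n+1) x := cut_nonneg _ _ x
    have h3 : ch1 (n+1) x ≤ 1 := cut_le_one _ _ x
    unfold PP
    rw [abs_of_nonneg (mul_nonneg h1.1 h2)]
    exact mul_le_one₀ h1.2 h2 h3
  · refine int_dom1 hF hT hσ (a2 := D - 1) (M := M) hM.le (pd_meas _ j) (supp_pd hs j) ?_ (by linarith)
    intro x hx hr
    rcases hb x hx hr j with h | h
    · exact Or.inr ⟨regA_mono hF h.1, h.2⟩
    · exact Or.inl h.2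

lemma NN_nice {i : Fin (n+1)} (hi : i ∈ T) : Nice (badZ F σ T) (NN D c F σ T i) := by
  have hk : (0:ℝ) < T.card := by exact_mod_cast hT.card_pos
  have hd := dpos σ
  have hs : ∀ x ∉ KK (n+1), NN D c F σ T i x = 0 := by
    intro x hx
    have : ∃ i, 99/100 < |x i| := by
      by_contra hc
      push Not at hc
      exact hx hc
    obtain ⟨m, hm⟩ := this
    rcases ch2_far σ x with h | h
    · simp [NN, h.self_of_nhds]
    · have hmσ : m = σ := by
        by_contra hne
        have h1 := h m hne
        have : 1 / (8 * ((n+1:ℕ):ℝ)) ≤ 1/8 := by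
          apply one_div_le_one_div_of_le <;> nlinarith
        linarith
      rw [hmσ] at hm
      have hr := rT_small hσ h
      have h3 : x ∉ regA F σ T 3 := fun h3 => by
        have := s_small hF h3 hr
        linarith
      rcases (rT_nonneg T x).eq_or_lt with h0 | h0
      · have := abs_le_rT hi x
        rw [← h0] at this
        have : x i = 0 := abs_nonpos_iff.1 this
        simp [NN, MM, this]
      · simp [NN, MM_zero hF i h0 h3]
  obtain ⟨M, hM, hb⟩ := NN_bd hF (σ := σ) (T := T)
  refine ⟨fun x hx => NN_diff hF hx hi, ?_, fun j => ?_, hs⟩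
  · refine int_dom1 hF hT hσ (a2 := 1 - T.card) (M := 1) zero_le_one
      ((MM_meas hF i).mul (cut_contDiff _ _).continuous.measurable) hs ?_ (by linarith [hF.D1])
    intro x _ hr
    have h2 : 0 ≤ ch2 σ x := cut_nonneg _ _ x
    have h3 : ch2 σ x ≤ 1 := cut_le_one _ _ x
    by_cases hA : x ∈ regA F σ T 3
    · right
      refine ⟨hA, ?_⟩
      have := MM_le hF (σ := σ) hi hr
      unfold NN
      rw [abs_mul, abs_of_nonneg h2, one_mul]
      calc _ ≤ rT T x ^ (1 - (T.card:ℝ)) * 1 := by gcongr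
        _ = _ := mul_one _
    · left
      simp [NN, MM_zero hF i hr hA]
  · refine int_dom1 hF hT hσ (a2 := -T.card) (M := M) hM.le (pd_meas _ j) (supp_pd hs j) ?_ (by linarith [hF.D1])
    intro x hx hr
    obtain ⟨h1, h2⟩ := hb x hx hr i hi j
    by_cases hA : x ∈ regA F σ T 3
    · exact Or.inr ⟨hA, h1⟩
    · left
      rw [h2 hA]; simpa using hM.le

lemma pair_neg : ∫ x in cube (n+1), ∑ i ∈ T, (pd (NN D c F σ T i) i x * pd (PP F σ T) σ x -
    pd (NN D c F σ T i) σ x * pd (PP F σ T) i x) < 0 := by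
  have hk : (0:ℝ) < T.card := by exact_mod_cast hT.card_pos
  set R : E (n+1) → ℝ := fun x => ∑ i ∈ T, x i * pd (ch2 σ) i x with hR
  set J : E (n+1) → ℝ := fun x => -(rT T x ^ (-(T.card:ℝ)) * R x * Qf F σ T x) with hJ
  have hRc : Continuous R := by
    refine continuous_finset_sum _ fun i _ => Continuous.mul (by fun_prop) ?_
    exact pd_cont (cut_contDiff _ _) i
  have hRn : ∀ x, R x ≤ 0 := fun x => Finset.sum_nonpos fun i _ => cut_mul_pd _ _ x i
  have hJn : ∀ x, 0 ≤ J x := by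
    intro x
    have h1 : 0 ≤ rT T x ^ (-(T.card:ℝ)) := Real.rpow_nonneg (rT_nonneg _ _) _
    have h2 := Qf_nonneg hF (σ := σ) (T := T) x
    have h3 := hRn x
    simp only [hJ]
    have := mul_nonneg (mul_nonneg h1 (neg_nonneg.2 h3)) h2
    linarith
  have e : ∫ x in cube (n+1), ∑ i ∈ T, (pd (NN D c F σ T i) i x * pd (PP F σ T) σ x -
      pd (NN D c F σ T i) σ x * pd (PP F σ T) i x) = - ∫ x in cube (n+1), J x := by
    rw [← integral_neg]
    refine integral_congr_ae ?_
    filter_upwards [ae_restrict_of_ae (ae_rT_pos hT)] with x hr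
    rw [pairing hF hσ hr]; simp only [hJ, hR, neg_neg]
  rw [e, neg_lt_zero]
  have hJm : Measurable J := by
    have h1 := (rT_cont T).measurable
    have h3 := hF.cont.measurable
    have h4 : Measurable fun x : E (n+1) => x σ := by fun_prop
    refine (((h1.pow_const _).mul hRc.measurable).mul ?_).neg
    exact ((h3.comp (h4.add h1)).sub (h3.comp (h4.sub h1))).div (h1.const_mul 2)
  obtain ⟨M, hM, hMb⟩ := rad_bd (σ := σ) hT
  have hIntg : IntegrableOn J (cube (n+1)) := by
    have hC := hF.C0
    have := int_dom hF hT hσ (q := 1) (a1 := D - 1) (a2 := 0) (M := M * C) one_pos (by positivity) hJm hJn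
      (fun x _ hr => Or.inl ?_) (by linarith [hF.D0, (show (1:ℝ) ≤ T.card by exact_mod_cast hT.card_pos)])
      (by linarith [hF.D1])
    · simpa using this
    · rw [← abs_of_nonneg (hJn x)]
      simp only [hJ, abs_neg]
      rw [abs_mul, abs_of_nonneg (Qf_nonneg hF x), mul_assoc]
      exact mul_le_mul (hMb x hr) (Qf_le hF hr) (Qf_nonneg hF x) hM.le
  rw [integral_pos_iff_support_of_nonneg hJn hIntg]
  -- the open set where the integrand is nonzero
  have hj : ∃ j, j ∈ T := hT
  obtain ⟨j0, hj0⟩ := hj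
  have hjσ : j0 ≠ σ := fun h => hσ (h ▸ hj0)
  have hρ := rho_pos σ
  obtain ⟨x0, hx1, hx2, hx3⟩ := bump_neg hρ
  have hd := dpos σ
  have hx0 : 0 < x0 := hρ.trans hx1
  have hx0' : x0 < 1 := by
    have : 2 * (1 / (16 * ((n+1:ℕ):ℝ))) ≤ 1 := by
      rw [mul_one_div, div_le_one (by positivity)]; linarith
    linarith
  set z : E (n+1) := EuclideanSpace.single j0 x0 with hz
  have hzj : z j0 = x0 := by simp [hz]
  have hzo : ∀ i, i ≠ j0 → z i = 0 := fun i hi => by simp [hz, hi]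
  have hzr : rT T z = x0 := by
    unfold rT
    rw [Finset.sum_eq_single j0 (fun i _ hi => by rw [hzo i hi]; simp) (fun h => absurd hj0 h), hzj,
      Real.sqrt_sq hx0.le]
  have hzR : R z < 0 := by
    simp only [hR]
    rw [Finset.sum_eq_single j0 (fun i _ hi => by rw [hzo i hi]; simp) (fun h => absurd hj0 h), hzj]
    have : pd (ch2 σ) j0 z = deriv (bump (1 / (16 * ((n+1:ℕ):ℝ)))) x0 := by
      unfold ch2
      rw [cut_pd_mem _ (by simp [hjσ]), hzj, Finset.prod_eq_one, mul_one]
      intro i hi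
      rw [hzo i (Finset.ne_of_mem_erase hi)]
      exact bump_one hρ (by simpa using hρ.le)
    rw [this]
    exact mul_neg_of_pos_of_neg hx0 hx3
  set U : Set (E (n+1)) := {x | R x < 0} ∩ regA F σ T 1 ∩ cube (n+1) with hU
  have hUo : IsOpen U := ((isOpen_lt hRc continuous_const).inter (regA_open hF.cont σ T 1)).inter (cube_open _)
  have hzU : z ∈ U := by
    refine ⟨⟨hzR, ?_⟩, ?_⟩
    · simp only [regA, mem_ofPred_eq, hzr, one_mul, hzo σ hjσ.symm]
      rw [hF.zero (0 - x0) (by linarith)]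
      exact hF.pos _ (by linarith)
    · intro i
      by_cases hi : i = j0
      · rw [hi, hzj]; exact ⟨by linarith, hx0'⟩
      · rw [hzo i hi]; norm_num
  have hUsub : U ⊆ Function.support J := by
    rintro x ⟨⟨h1, h2⟩, -⟩
    have hr := regA_pos hF h2
    have hQ : 0 < Qf F σ T x := by
      simp only [regA, mem_ofPred_eq, one_mul] at h2
      exact div_pos (by linarith) (by linarith)
    have h1 : R x < 0 := h1
    have hp : 0 < rT T x ^ (-(T.card:ℝ)) := by positivity
    have : J x ≠ 0 := by
      simp only [hJ]
      exact neg_ne_zero.2 (mul_ne_zero (mul_ne_zero hp.ne' h1.ne) hQ.ne')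
    exact this
  calc 0 < volume U := hUo.measure_pos volume ⟨z, hzU⟩
    _ = (volume.restrict (cube (n+1))) U := by
        rw [Measure.restrict_apply hUo.measurableSet, inter_eq_left.2 inter_subset_right]
    _ ≤ _ := measure_mono hUsub

end



lemma meas_nrm {d : ℕ} {v : E d → E d} (h : ∀ i, Measurable fun x => v x i) : Measurable fun x => ‖v x‖ := by
  simp only [EuclideanSpace.norm_eq]
  have : Measurable fun x => ∑ i, ‖v x i‖ ^ 2 :=
    Finset.measurable_sum _ fun i _ => (h i).norm.pow_const 2
  exact this.sqrt

lemma caseA (n : ℕ) (hn : 1 ≤ n) (p : ℝ) (hp : 1 < p) :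
    WeightedGapExample (n+1) p
      (fun α _ ω => 0 ≤ α ∧ ∃ M : ℝ, ∀ x ∈ cube (n+1), ω x ≤ M) := by
  obtain ⟨D, hD0, hD1, hD2⟩ : ∃ D : ℝ, 0 < D ∧ D < 1 ∧ 2 - p < D := by
    obtain ⟨D, h1, h2⟩ := exists_between (show max 0 (2-p) < 1 from max_lt (by norm_num) (by linarith))
    exact ⟨D, (le_max_left _ _).trans_lt h1, h2, (le_max_right _ _).trans_lt h1⟩
  have hp0 : 0 < p := by linarith
  have hip : 1 / p < 1 := by rw [div_lt_one hp0]; exact hp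
  have hip0 : 0 < 1 / p := by positivity
  obtain ⟨β, hβ0, hβ1, hβ2⟩ : ∃ β : ℝ, 0 < β ∧ β < 1 - 1/p ∧ 1 - (2-D)/p < β := by
    have h3 : 1 - (2-D)/p < 1 - 1/p := by
      have : 1 / p < (2-D)/p := by gcongr; linarith
      linarith
    obtain ⟨D, h1, h2⟩ := exists_between (max_lt (show 0 < 1 - 1/p by linarith) h3)
    exact ⟨D, (le_max_left _ _).trans_lt h1, h2, (le_max_right _ _).trans_lt h1⟩
  obtain ⟨C, c, F, hF⟩ := exists_CF hD0 hD1
  set l : Fin (n+1) := Fin.last n with hl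
  set σ : Fin (n+1) := 0 with hσd
  have hlσ : σ ≠ l := by
    intro h
    have := congrArg Fin.val h
    simp [hl, hσd] at this
    omega
  set T : Finset (Fin (n+1)) := {l} with hTd
  have hT : T.Nonempty := Finset.singleton_nonempty _
  have hσ : σ ∉ T := by simpa [hTd] using hlσ
  have hcard : (T.card : ℝ) = 1 := by simp [hTd]
  have hr : ∀ x, rT T x = |x l| := by intro x; simp [rT, hTd, Real.sqrt_sq_eq_abs]
  have hxd : ∀ x, |xd (n+1) x| = rT T x := by
    intro x
    rw [hr]
    simp [xd, hl, Fin.last]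
  have hr1 : ∀ x ∈ cube (n+1), rT T x ≤ 1 := by
    intro x hx
    rw [hr]
    exact abs_le.2 ⟨(hx l).1.le, (hx l).2.le⟩
  classical
  let ω : E (n+1) → ℝ := fun x => if x ∈ regA F σ T 1 then 1 else rT T x ^ β
  have hωm : Measurable ω :=
    Measurable.ite (regA_open hF.cont σ T 1).measurableSet measurable_const
      ((rT_cont T).measurable.pow_const β)
  have hω0 : ∀ x, 0 ≤ ω x := by
    intro x
    simp only [ω]
    split_ifs
    · norm_num
    · exact Real.rpow_nonneg (rT_nonneg _ _) _
  have hrb : ∀ x ∈ cube (n+1), rT T x ^ β ≤ 1 := fun x hx =>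
    Real.rpow_le_one (rT_nonneg _ _) (hr1 x hx) hβ0.le
  have hω1 : ∀ x ∈ cube (n+1), ω x ≤ 1 := by
    intro x hx
    simp only [ω]
    split_ifs
    · exact le_rfl
    · exact hrb x hx
  have hω2 : ∀ x ∈ cube (n+1), rT T x ^ β ≤ ω x := by
    intro x hx
    simp only [ω]
    split_ifs
    · exact hrb x hx
    · exact le_rfl
  obtain ⟨M1, hM1, hP⟩ := PP_bd (σ := σ) (T := T) hF
  obtain ⟨M2, hM2, hN⟩ := NN_bd (σ := σ) (T := T) hF
  obtain ⟨M3, hM3, hN'⟩ := NN_in_bd hF hσ hT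
  have hlT : l ∈ T := by simp [hTd]
  have hd1 : (1:ℝ) ≤ ((n+1 : ℕ) : ℝ) := dpos σ
  have hq : 0 < p / (p-1) := div_pos hp0 (by linarith)
  refine ⟨0, β, 1, ω, fun x => CC (PP F σ T) σ l x, hβ0, one_pos, hωm, hω0, ⟨le_rfl, 1, hω1⟩,
    Or.inl ⟨⟨by linarith, by linarith⟩, ⟨by linarith, hβ1⟩, ?_⟩, ?_⟩
  · intro x hx
    rw [hxd, one_mul, Real.rpow_zero]
    exact ⟨hω2 x hx, hω1 x hx⟩
  refine finish (badZ_slice hF hT hσ) hp ({()} : Finset Unit) (fun _ => PP F σ T) (fun _ => σ) l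
    (fun _ _ => PP_nice hF hσ hT) (NN_nice hF hσ hT hlT) hω0 _ (fun x => by simp) ?_ ?_ ?_
  · refine int_dom hF hT hσ (a1 := -β) (a2 := D - 1) (M := (n+1 : ℕ) * (2 * M1)) hq (by positivity) ?_ ?_ ?_ ?_ ?_
    · refine (meas_nrm fun i => ?_).div hωm
      simp only [CC_apply]
      refine Measurable.sub ?_ ?_ <;> split_ifs <;> first | exact pd_meas _ _ | exact measurable_const
    · intro x
      exact div_nonneg (norm_nonneg _) (hω0 x)
    · intro x hx hrp
      have cmp : ∀ B, 0 ≤ B → (∀ j, |pd (PP F σ T) j x| ≤ B) → ‖CC (PP F σ T) σ l x‖ ≤ (n+1:ℕ) * (2 * B) := by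
        intro B hB h
        refine norm_le_of fun m => ?_
        rw [CC_apply]
        refine (abs_sub _ _).trans ?_
        have : ∀ (q : Prop) [Decidable q] j, |if q then pd (PP F σ T) j x else 0| ≤ B := by
          intro q _ j
          split_ifs
          · exact h j
          · simpa using hB
        have := this (m = l) σ
        have := ‹∀ (q : Prop) [Decidable q] j, |if q then pd (PP F σ T) j x else 0| ≤ B› (m = σ) l
        linarith
      by_cases hx1 : x ∈ regA F σ T 1
      · right
        refine ⟨regA_mono hF hx1, ?_⟩
        have := cmp (M1 * rT T x ^ (D-1)) (by positivity) fun j => by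
          rcases hP x hx hrp j with h | h
          · exact h.2
          · exact absurd hx1 h.1
        simp only [ω, if_pos hx1, div_one]
        linarith
      · left
        have := cmp M1 hM1.le fun j => by
          rcases hP x hx hrp j with h | h
          · exact absurd h.1 hx1
          · exact h.2
        simp only [ω, if_neg hx1]
        rw [Real.rpow_neg hrp.le, ← div_eq_mul_inv]
        gcongr
    · rw [hcard]
      have : β * (p/(p-1)) < 1 := by
        rw [← mul_div_assoc, div_lt_one (by linarith)]
        have := mul_lt_mul_of_pos_right hβ1 hp0
        rw [sub_mul, one_div, inv_mul_cancel₀ hp0.ne'] at this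
        linarith
      linarith
    · rw [hcard]
      have : (1 - D) * (p/(p-1)) < 2 - D := by
        rw [← mul_div_assoc, div_lt_iff₀ (by linarith)]
        nlinarith
      nlinarith
  · refine int_dom hF hT hσ (a1 := 0) (a2 := β - 1) (M := (n+1 : ℕ) * (M2 + M3)) hp0 (by positivity) ?_ ?_ ?_ ?_ ?_
    · refine hωm.mul (meas_nrm fun i => ?_)
      simp only [grad_apply]
      exact pd_meas _ _
    · intro x
      exact mul_nonneg (hω0 x) (norm_nonneg _)
    · intro x hx hrp
      by_cases hx1 : x ∈ regA F σ T 1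
      · left
        obtain ⟨k1, k2, k3⟩ := hN' x hx1
        have : ‖gradient (NN D c F σ T l) x‖ ≤ (n+1:ℕ) * M3 := norm_le_of fun j => by
          rw [grad_apply]
          by_cases hj : j ∈ T
          · have : j = l := by simpa [hTd] using hj
            subst this
            simpa [hTd] using k1
          · have := k3 l hlT j hj
            rw [hcard] at this
            simpa using this
        simp only [ω, if_pos hx1, one_mul, Real.rpow_zero, mul_one]
        refine this.trans ?_
        gcongr
        linarith
      · by_cases hx3 : x ∈ regA F σ T 3
        · right
          refine ⟨hx3, ?_⟩
          have : ‖gradient (NN D c F σ T l) x‖ ≤ (n+1:ℕ) * (M2 * rT T x ^ (-1:ℝ)) := norm_le_of fun j => by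
            rw [grad_apply]
            have := (hN x hx hrp l hlT j).1
            rwa [hcard] at this
          simp only [ω, if_neg hx1]
          rw [sub_eq_add_neg, Real.rpow_add hrp]
          calc rT T x ^ β * ‖gradient (NN D c F σ T l) x‖ ≤ rT T x ^ β * ((n+1:ℕ) * (M2 * rT T x ^ (-1:ℝ))) := by gcongr
            _ = (n+1:ℕ) * M2 * (rT T x ^ β * rT T x ^ (-1:ℝ)) := by ring
            _ ≤ _ := by gcongr; linarith
        · left
          have : gradient (NN D c F σ T l) x = 0 := by
            ext j
            rw [grad_apply]
            simpa using (hN x hx hrp l hlT j).2 hx3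
          rw [this]
          simp
          positivity
    · rw [hcard]; simp
    · rw [hcard]
      have := mul_lt_mul_of_pos_right hβ2 hp0
      rw [sub_mul, div_mul_cancel₀ _ hp0.ne'] at this
      nlinarith
  · have := pair_neg hF hσ hT
    simp only [CC_inner]
    convert this using 3 with x
    simp only [hTd, Finset.sum_singleton]
    ring



lemma caseB (n : ℕ) (hn : 1 ≤ n) (p : ℝ) (hp : 1 < p) :
    WeightedGapExample (n+1) p
      (fun _ β ω => β ≤ 0 ∧ ∃ M : ℝ, ∀ x ∈ cube (n+1), 1 / ω x ≤ M) := by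
  have hp0 : 0 < p := by linarith
  have hip : 1 / p < 1 := by rw [div_lt_one hp0]; exact hp
  have hip0 : 0 < 1 / p := by positivity
  have hn1 : (1:ℝ) ≤ n := by exact_mod_cast hn
  obtain ⟨D, hD0, hD1, hDd⟩ : ∃ D : ℝ, 0 < D ∧ D < 1 ∧ 1 - D < 1 / p := by
    refine ⟨1 - 1/p/2, by linarith, by linarith, by linarith⟩
  obtain ⟨τ, hτ, hτ0, hτ1⟩ : ∃ τ : ℝ, τ * p = (1-D)*p - (n+1-D) ∧ τ < 0 ∧ -(n/p) < τ := by
    have e : ((1-D) - (n+1-D)/p) * p = (1-D)*p - (n+1-D) := by field_simp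
    have h1 : (1-D)*p < 1 := by rwa [lt_div_iff₀ hp0] at hDd
    refine ⟨(1-D) - (n+1-D)/p, e, ?_, ?_⟩
    · have : ((1-D) - (n+1-D)/p) * p < 0 := by rw [e]; linarith
      exact neg_of_mul_neg_left this hp0.le
    · have : -(n/p) * p < ((1-D) - (n+1-D)/p) * p := by
        rw [e, neg_mul, div_mul_cancel₀ _ hp0.ne']
        nlinarith
      exact lt_of_mul_lt_mul_right this hp0.le
  obtain ⟨β, hβ1, hβ0⟩ := exists_between hτ0
  obtain ⟨α, hα1, hα2⟩ := exists_between hτ1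
  have hαβ : α < β := hα2.trans hβ1
  have hα0 : α < 0 := hαβ.trans hβ0
  have hnp : 0 < (n:ℝ) * (1 - 1/p) := mul_pos (by linarith) (by linarith)
  obtain ⟨C, c, F, hF⟩ := exists_CF hD0 hD1
  set σ : Fin (n+1) := Fin.last n with hσd
  set T : Finset (Fin (n+1)) := Finset.univ.filter (fun i => (i:ℕ) < n) with hTd
  have hσ : σ ∉ T := by simp [hTd, hσd]
  have hT : T.Nonempty := ⟨0, by simp [hTd]; omega⟩
  have hTc : T = Finset.univ.erase σ := by
    ext i
    simp only [hTd, Finset.mem_filter, Finset.mem_univ, true_and, Finset.mem_erase, and_true, hσd, ne_eq, Fin.ext_iff,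
      Fin.val_last]
    have := i.2
    omega
  have hcard : (T.card : ℝ) = n := by
    rw [hTc, Finset.card_erase_of_mem (Finset.mem_univ _)]; simp
  have hTm : ∀ j, j ∉ T → j = σ := by
    intro j hj
    simpa [hTc] using hj
  have hbn : ∀ x, barNorm (n+1) x = rT T x := by
    intro x
    simp [barNorm, rT, hTd, Finset.sum_filter]
  have hd1 : (1:ℝ) ≤ ((n+1 : ℕ) : ℝ) := dpos σ
  have hdp : (0:ℝ) < ((n+1 : ℕ) : ℝ) := by linarith
  set ε : ℝ := ((n+1 : ℕ) : ℝ) ^ (α - β) with hε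
  have hε0 : 0 < ε := Real.rpow_pos_of_pos hdp _
  have hε1 : ε ≤ 1 := Real.rpow_le_one_of_one_le_of_nonpos hd1 (by linarith)
  have key : ∀ x ∈ cube (n+1), ε * rT T x ^ β ≤ rT T x ^ α := by
    intro x hx
    rcases (rT_nonneg T x).eq_or_lt with h | h
    · rw [← h, Real.zero_rpow hβ0.ne, Real.zero_rpow hα0.ne]; simp
    · have : ε ≤ rT T x ^ (α - β) :=
        Real.rpow_le_rpow_of_nonpos h (rT_le_cube hx) (by linarith)
      calc ε * rT T x ^ β ≤ rT T x ^ (α - β) * rT T x ^ β := by gcongr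
        _ = _ := by rw [← Real.rpow_add h]; congr 1; ring
  classical
  let ω : E (n+1) → ℝ := fun x => if x ∈ regA F σ T 1 then ε * rT T x ^ β else rT T x ^ α
  have hωm : Measurable ω :=
    Measurable.ite (regA_open hF.cont σ T 1).measurableSet
      (((rT_cont T).measurable.pow_const β).const_mul ε)
      ((rT_cont T).measurable.pow_const α)
  have hω0 : ∀ x, 0 ≤ ω x := by
    intro x
    have := rT_nonneg T x
    simp only [ω]
    split_ifs <;> positivity
  have hω1 : ∀ x ∈ cube (n+1), ω x ≤ rT T x ^ α := by
    intro x hx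
    simp only [ω]
    split_ifs
    · exact key x hx
    · exact le_rfl
  have hω2 : ∀ x ∈ cube (n+1), ε * rT T x ^ β ≤ ω x := by
    intro x hx
    simp only [ω]
    split_ifs
    · exact le_rfl
    · exact key x hx
  have hinv : ∀ x ∈ cube (n+1), 1 / ω x ≤ ((n+1 : ℕ) : ℝ) ^ (-β) / ε := by
    intro x hx
    rcases (rT_nonneg T x).eq_or_lt with h | h
    · have h1 := hω1 x hx
      rw [← h, Real.zero_rpow hα0.ne] at h1
      rw [le_antisymm h1 (hω0 x)]
      simp
      positivity
    · have h1 : ((n+1 : ℕ) : ℝ) ^ β ≤ rT T x ^ β :=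
        Real.rpow_le_rpow_of_nonpos h (rT_le_cube hx) hβ0.le
      calc 1 / ω x ≤ 1 / (ε * ((n+1 : ℕ) : ℝ) ^ β) := by
            refine one_div_le_one_div_of_le (by positivity) (le_trans ?_ (hω2 x hx))
            gcongr
        _ = _ := by rw [Real.rpow_neg hdp.le]; field_simp
  obtain ⟨M1, hM1, hP⟩ := PP_bd (σ := σ) (T := T) hF
  obtain ⟨M2, hM2, hN⟩ := NN_bd (σ := σ) (T := T) hF
  obtain ⟨M3, hM3, hN'⟩ := NN_in_bd hF hσ hT
  have hq : 0 < p / (p-1) := div_pos hp0 (by linarith)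
  set B : ℝ := ((n+1 : ℕ) : ℝ) ^ (-β) / ε with hB
  have hB0 : 0 < B := by positivity
  set b0 : E (n+1) → E (n+1) := fun x => ∑ i ∈ T, CC (NN D c F σ T i) i σ x with hb0
  have hbσ : ∀ x, b0 x σ = ∑ i ∈ T, pd (NN D c F σ T i) i x := by
    intro x
    simp only [hb0, WithLp.ofLp_sum, Finset.sum_apply, CC_apply]
    refine Finset.sum_congr rfl fun i hi => ?_
    have : σ ≠ i := fun h => hσ (h ▸ hi)
    simp [this]
  have hbT : ∀ x, ∀ j ∈ T, b0 x j = - pd (NN D c F σ T j) σ x := by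
    intro x j hj
    have h1 : j ≠ σ := fun h => hσ (h ▸ hj)
    simp only [hb0, WithLp.ofLp_sum, Finset.sum_apply, CC_apply]
    simp [h1, hj]
  refine ⟨α, β, ε, ω, b0, hαβ, hε0, hωm, hω0, ⟨hβ0.le, B, hinv⟩,
    Or.inr ⟨?_, ?_, ?_⟩, ?_⟩
  · push_cast
    rw [add_sub_cancel_right]
    exact ⟨hα1, by linarith⟩
  · push_cast
    rw [add_sub_cancel_right]
    exact ⟨by linarith, by linarith⟩
  · intro x hx
    rw [hbn]
    exact ⟨hω2 x hx, hω1 x hx⟩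
  refine finish (badZ_slice hF hT hσ) hp T (fun i => NN D c F σ T i) (fun i => i) σ
    (fun i hi => NN_nice hF hσ hT hi) (PP_nice hF hσ hT) hω0 _ (fun x => rfl) ?_ ?_ ?_
  · refine int_dom hF hT hσ (a1 := 0) (a2 := -(n+α)) (M := (n+1 : ℕ) * M3 * B + (n+1 : ℕ) * ((n+1 : ℕ) * M2)) hq (by positivity) ?_ ?_ ?_ ?_ ?_
    · refine (meas_nrm fun j => ?_).div hωm
      by_cases hj : j ∈ T
      · simp only [hbT _ j hj]
        exact (pd_meas _ _).neg
      · rw [hTm j hj]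
        simp only [hbσ]
        exact Finset.measurable_sum _ fun i _ => pd_meas _ _
    · intro x
      exact div_nonneg (norm_nonneg _) (hω0 x)
    · intro x hx hrp
      by_cases hx1 : x ∈ regA F σ T 1
      · left
        obtain ⟨k1, k2, k3⟩ := hN' x hx1
        have h1 : ‖b0 x‖ ≤ (n+1:ℕ) * M3 := norm_le_of fun j => by
          by_cases hj : j ∈ T
          · rw [hbT x j hj, k2 j hj]
            simpa using hM3.le
          · rw [hTm j hj, hbσ]
            exact k1
        rw [Real.rpow_zero, mul_one, div_eq_mul_one_div]
        calc ‖b0 x‖ * (1 / ω x) ≤ (n+1:ℕ) * M3 * B := by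
              have := hω0 x
              have := hinv x hx
              gcongr
          _ ≤ _ := le_add_of_nonneg_right (by positivity)
      · by_cases hx3 : x ∈ regA F σ T 3
        · right
          refine ⟨hx3, ?_⟩
          have hpd : ∀ i ∈ T, ∀ j, |pd (NN D c F σ T i) j x| ≤ M2 * rT T x ^ (-(n:ℝ)) := by
            intro i hi j
            have := (hN x hx hrp i hi j).1
            rwa [hcard] at this
          have h0 : 0 ≤ M2 * rT T x ^ (-(n:ℝ)) := by positivity
          have h1 : ‖b0 x‖ ≤ (n+1:ℕ) * ((n+1:ℕ) * (M2 * rT T x ^ (-(n:ℝ)))) := norm_le_of fun j => by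
            by_cases hj : j ∈ T
            · rw [hbT x j hj, abs_neg]
              refine (hpd j hj σ).trans ?_
              exact le_mul_of_one_le_left h0 hd1
            · rw [hTm j hj, hbσ]
              refine (Finset.abs_sum_le_sum_abs _ _).trans ((Finset.sum_le_sum fun i hi => hpd i hi i).trans ?_)
              rw [Finset.sum_const, nsmul_eq_mul, hcard]
              gcongr
              push_cast
              linarith
          simp only [ω, if_neg hx1]
          rw [neg_add, Real.rpow_add hrp, Real.rpow_neg hrp.le α, div_eq_mul_inv]
          calc ‖b0 x‖ * (rT T x ^ α)⁻¹ ≤ (n+1:ℕ) * ((n+1:ℕ) * (M2 * rT T x ^ (-(n:ℝ)))) * (rT T x ^ α)⁻¹ := by gcongr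
            _ = (n+1:ℕ) * ((n+1:ℕ) * M2) * (rT T x ^ (-(n:ℝ)) * (rT T x ^ α)⁻¹) := by ring
            _ ≤ _ := by
              gcongr
              exact le_add_of_nonneg_left (by positivity)
        · left
          have : b0 x = 0 := by
            ext j
            by_cases hj : j ∈ T
            · rw [hbT x j hj, (hN x hx hrp j hj σ).2 hx3]; simp
            · rw [hTm j hj, hbσ]
              simpa using Finset.sum_eq_zero fun i hi => (hN x hx hrp i hi i).2 hx3
          rw [this, norm_zero, zero_div]
          positivity
    · rw [hcard]; linarith
    · rw [hcard]
      have : (n + α) * (p/(p-1)) < n + 1 - D := by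
        rw [← mul_div_assoc, div_lt_iff₀ (by linarith)]
        have := mul_lt_mul_of_pos_right hα2 hp0
        rw [hτ] at this
        nlinarith
      linarith
  · refine int_dom hF hT hσ (a1 := α) (a2 := β + (D - 1)) (M := (n+1 : ℕ) * M1) hp0 (by positivity) ?_ ?_ ?_ ?_ ?_
    · refine hωm.mul (meas_nrm fun i => ?_)
      simp only [grad_apply]
      exact pd_meas _ _
    · intro x
      exact mul_nonneg (hω0 x) (norm_nonneg _)
    · intro x hx hrp
      by_cases hx1 : x ∈ regA F σ T 1
      · right
        refine ⟨regA_mono hF hx1, ?_⟩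
        have : ‖gradient (PP F σ T) x‖ ≤ (n+1:ℕ) * (M1 * rT T x ^ (D-1)) := norm_le_of fun j => by
          rw [grad_apply]
          rcases hP x hx hrp j with h | h
          · exact h.2
          · exact absurd hx1 h.1
        simp only [ω, if_pos hx1]
        rw [Real.rpow_add hrp]
        calc ε * rT T x ^ β * ‖gradient (PP F σ T) x‖ ≤ 1 * rT T x ^ β * ((n+1:ℕ) * (M1 * rT T x ^ (D-1))) := by gcongr
          _ = _ := by ring
      · left
        have : ‖gradient (PP F σ T) x‖ ≤ (n+1:ℕ) * M1 := norm_le_of fun j => by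
          rw [grad_apply]
          rcases hP x hx hrp j with h | h
          · exact absurd h.1 hx1
          · exact h.2
        simp only [ω, if_neg hx1]
        rw [mul_comm]
        gcongr
    · rw [hcard]
      have := mul_lt_mul_of_pos_right hα1 hp0
      rw [neg_mul, div_mul_cancel₀ _ hp0.ne'] at this
      linarith
    · rw [hcard]
      have := mul_lt_mul_of_pos_right hβ1 hp0
      rw [hτ] at this
      linarith
  · have := pair_neg hF hσ hT
    simpa only [hb0, sum_inner, CC_inner] using this

theorem statement_19 (d : ℕ) (hd : 2 ≤ d) (p : ℝ) (hp : 1 < p) :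
    WeightedGapExample d p (fun _ _ _ => True) ∧
    WeightedGapExample d p
      (fun α _ ω => 0 ≤ α ∧ ∃ M : ℝ, ∀ x ∈ cube d, ω x ≤ M) ∧
    WeightedGapExample d p
      (fun _ β ω => β ≤ 0 ∧ ∃ M : ℝ, ∀ x ∈ cube d, 1 / ω x ≤ M) := by
  obtain ⟨n, rfl⟩ : ∃ n, d = n + 1 := ⟨d - 1, by omega⟩
  have hn : 1 ≤ n := by omega
  refine ⟨?_, caseA n hn p hp, caseB n hn p hp⟩
  obtain ⟨α, β, ε, ω, b0, h1, h2, h3, h4, -, h⟩ := caseA n hn p hp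
  exact ⟨α, β, ε, ω, b0, h1, h2, h3, h4, trivial, h⟩
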